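/- arXiv:2504.17957 — 4 statements merged into one kernel-verified Lean document; each statement's English description precedes it below -/
import Mathlib

section
/- Let R be an order in a number field K with conductor I. Then Nat.card(Cl(R)) · Nat.card(U(R/(I∩R))) · Nat.card(U(𝓞_K)/U(R)) = Nat.card(Cl(𝓞_K)) · Nat.card(U(𝓞_K/I)), where U(R/(I∩R)) is the unit group of the quotient ring of R by the conductor regarded as an ideal of R, U(𝓞_K/I) is the unit group of 𝓞_K/I, and U(𝓞_K)/U(R) is the quotient group of the units of 𝓞_K by the subgroup of those units that lie in R. -/
set_option synthInstance.maxHeartbeats 1000000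
set_option maxHeartbeats 1000000

open NumberField

/-- The conductor of a subring `R` of the ring of integers `𝓞 K`:
the set of `x ∈ 𝓞 K` such that `x • 𝓞 K ⊆ R`, as an ideal of `𝓞 K`. -/
noncomputable def conductorIdeal {K : Type*} [Field K] [NumberField K] (R : Subring (𝓞 K)) :
    Ideal (𝓞 K) where
  carrier := {x | ∀ y : 𝓞 K, x * y ∈ R}
  add_mem' := fun {a b} ha hb y => by
    simpa [add_mul] using R.add_mem (ha y) (hb y)
  zero_mem' := fun y => by simpa using R.zero_mem
  smul_mem' := fun c x hx y => by
    simpa [smul_eq_mul, mul_comm, mul_assoc, mul_left_comm] using hx (c * y)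

/-- The subgroup of the units of `𝓞 K` consisting of the units lying in `R`
(i.e. both the unit and its inverse, elements of `𝓞 K`, belong to `R`). -/
def unitsInOrder {K : Type*} [Field K] [NumberField K] (R : Subring (𝓞 K)) :
    Subgroup (𝓞 K)ˣ where
  carrier := {u | ((u : (𝓞 K)ˣ) : 𝓞 K) ∈ R ∧ ((u⁻¹ : (𝓞 K)ˣ) : 𝓞 K) ∈ R}
  one_mem' := ⟨R.one_mem, by simpa using R.one_mem⟩
  mul_mem' := fun {a b} ha hb =>
    ⟨by simpa using R.mul_mem ha.1 hb.1, by simpa [mul_inv_rev] using R.mul_mem hb.2 ha.2⟩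
  inv_mem' := fun {a} ha => ⟨ha.2, by simpa using ha.1⟩


namespace OrderClassNumber

open scoped Pointwise

/-- An invertible submodule contains an element which, paired with an element of the inverse,
is congruent to one modulo a given ideal of finite index. -/
theorem exists_mul_eq_one_mod {A K : Type*} [CommRing A] [Field K] [Algebra A K]
    (hinj : Function.Injective (algebraMap A K)) (c : Ideal A) [Finite (A ⧸ c)]
    (J J' : Submodule A K) (h : J * J' = 1) :
    ∃ x ∈ J, ∃ y ∈ J', ∃ a : A, algebraMap A K a = x * y ∧ 1 - a ∈ c := by
  classical
  have hf : {M : Ideal A | M.IsMaximal ∧ c ≤ M}.Finite := by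
    refine Set.Finite.of_finite_image (f := fun M : Ideal A => M.map (Ideal.Quotient.mk c))
      (Set.toFinite _) ?_
    intro M hM N hN hMN
    have := congrArg (Ideal.comap (Ideal.Quotient.mk c)) hMN
    simpa [Ideal.comap_map_of_surjective _ Ideal.Quotient.mk_surjective,
      ← RingHom.ker_eq_comap_bot, hM.2, hN.2] using this
  let s := hf.toFinset
  have hs : ∀ M ∈ s, M.IsMaximal ∧ c ≤ M := fun M hM => hf.mem_toFinset.1 hM
  have coprime : ∀ M ∈ s, ∀ M' ∈ s.erase M, M ⊔ M' = ⊤ := by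
    intro M hM M' hM'
    rw [Finset.mem_erase] at hM'
    exact Ideal.IsMaximal.coprime_of_ne (hs M hM).1 (hs M' hM'.2).1 hM'.1.symm
  have nle : ∀ M ∈ s, ¬⨅ M' ∈ s.erase M, M' ≤ M := fun M hM =>
    left_lt_sup.1
      ((hs M hM).1.lt_top.trans_eq (Ideal.sup_iInf_eq_top <| coprime M hM).symm)
  have key : ∀ a ∈ J, ∀ b ∈ J', ∃ c, algebraMap A K c = a * b := by
    intro a ha b hb
    exact Submodule.mem_one.1 (h ▸ Submodule.mul_mem_mul ha hb)
  have : ∀ M ∈ s, ∃ a ∈ J, ∃ b ∈ J', ∀ c, algebraMap A K c = a * b → c ∉ M := by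
    intro M hM; by_contra! h'
    have h1 : J * J' ≤ Submodule.map (Algebra.linearMap A K) M := by
      refine Submodule.mul_le.2 fun a ha b hb => ?_
      obtain ⟨c, hc, hcM⟩ := h' a ha b hb
      exact ⟨c, hcM, hc⟩
    rw [h] at h1
    obtain ⟨c, hc, hc1⟩ := h1 (Submodule.mem_one.2 ⟨1, map_one _⟩)
    have : c = 1 := hinj (by simpa using hc1)
    exact (hs M hM).1.ne_top ((Ideal.eq_top_iff_one _).2 (this ▸ hc))
  choose! a ha b hb hm using this
  choose! u hu hum using fun M hM => SetLike.not_le_iff_exists.1 (nle M hM)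
  let v := ∑ M ∈ s, u M • b M
  have hv : v ∈ J' := Submodule.sum_mem _ fun M hM => Submodule.smul_mem _ _ <| hb M hM
  let T : Ideal A :=
    (J.map (LinearMap.mulLeft A v)).comap (Algebra.linearMap A K)
  have hT : T ⊔ c = ⊤ := by
    by_contra hne
    obtain ⟨M, hM, hTM⟩ := Ideal.exists_le_maximal _ hne
    have hMs : M ∈ s := hf.mem_toFinset.2 ⟨hM, le_sup_right.trans hTM⟩
    choose! d hd using fun M' (hM' : M' ∈ s) => key (a M) (ha M hMs) (b M') (hb M' hM')
    have hsum : algebraMap A K (∑ M' ∈ s, u M' * d M') = v * a M := by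
      simp only [v, map_sum, map_mul, Finset.sum_mul]
      refine Finset.sum_congr rfl fun M' hM' => ?_
      rw [hd M' hM', Algebra.smul_def]; ring
    have hmem : ∑ M' ∈ s, u M' * d M' ∈ M :=
      hTM (Ideal.mem_sup_left ⟨a M, ha M hMs, hsum.symm⟩)
    rw [← s.add_sum_erase _ hMs, Ideal.add_mem_iff_left] at hmem
    · exact (hM.isPrime.mem_or_mem hmem).elim (hum M hMs) (hm M hMs _ (hd M hMs))
    · refine Submodule.sum_mem _ fun M' hM' => ?_
      rw [Finset.mem_erase] at hM'
      have := hu M' hM'.2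
      simp_rw [Ideal.mem_iInf, Finset.mem_erase] at this
      exact M.mul_mem_right _ (this M ⟨hM'.1.symm, hMs⟩)
  obtain ⟨t, ⟨x, hx, hxt⟩, e, he, hte⟩ := Submodule.mem_sup.1 ((Ideal.eq_top_iff_one _).1 hT)
  refine ⟨x, hx, v, hv, t, ?_, ?_⟩
  · rw [mul_comm x]; exact hxt.symm
  · rw [← hte]; simpa using he

section generic

variable {A B K : Type*} [CommRing A] [CommRing B] [Field K] [Algebra A B] [Algebra A K]
  [Algebra B K] [IsScalarTower A B K]

/-- The principal submodules. -/
noncomputable abbrev prin (A K : Type*) [CommRing A] [Field K] [Algebra A K] :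
    Kˣ →* (Submodule A K)ˣ := Units.map (Submodule.spanSingleton A).toMonoidHom

/-- The class group in terms of invertible submodules of `K`. -/
abbrev CL (A K : Type*) [CommRing A] [Field K] [Algebra A K] :=
  (Submodule A K)ˣ ⧸ (prin A K).range

theorem card_classGroup (A K : Type*) [CommRing A] [IsDomain A] [Field K] [Algebra A K]
    [IsFractionRing A K] : Nat.card (ClassGroup A) = Nat.card (CL A K) := by
  refine Nat.card_congr ((ClassGroup.equiv K).trans
    (QuotientGroup.congr _ _ FractionalIdeal.unitsMulEquivSubmodule ?_)).toEquiv
  simp_rw [MonoidHom.range_eq_map, Subgroup.map_map]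
  congr; ext; simp [FractionalIdeal.unitsMulEquivSubmodule]

variable (A B K) in
/-- Extension of submodules. -/
noncomputable def ext : Submodule A K →* Submodule B K where
  toFun M := Submodule.span B (M : Set K)
  map_one' := by
    rw [Submodule.one_eq_span, Submodule.span_span_of_tower, Submodule.one_eq_span]
  map_mul' M N := by
    have h : M * N = Submodule.span A ((M : Set K) * (N : Set K)) := by
      rw [← Submodule.span_mul_span, Submodule.span_eq, Submodule.span_eq]
    rw [Submodule.span_mul_span, h, Submodule.span_span_of_tower]

theorem ext_apply (M : Submodule A K) : ext A B K M = Submodule.span B (M : Set K) := rfl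

variable (A B K) in
/-- Extension of classes. -/
noncomputable def extCL : CL A K →* CL B K :=
  QuotientGroup.map _ _ (Units.map (ext A B K)) (by
    rintro _ ⟨x, rfl⟩
    refine ⟨x, Units.ext ?_⟩
    change Submodule.span B {(x : K)} = Submodule.span B (Submodule.span A {(x : K)} : Set K)
    rw [Submodule.span_span_of_tower])

variable (A K) in
/-- The submodule `b A + I`. -/
noncomputable def Jmod {I : Ideal B} (b : B ⧸ I) : Submodule A K :=
  ((Submodule.span A {b}).comap (Ideal.Quotient.mkₐ A I).toLinearMap).map
    (IsScalarTower.toAlgHom A B K).toLinearMap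

theorem mem_Jmod {I : Ideal B} {b : B ⧸ I} {k : K} : k ∈ Jmod A K b ↔
    ∃ x : B, (∃ a : A, Ideal.Quotient.mk I (algebraMap A B a) * b = Ideal.Quotient.mk I x) ∧
      algebraMap B K x = k := by
  simp only [Jmod, Submodule.mem_map, Submodule.mem_comap, Submodule.mem_span_singleton,
    Algebra.smul_def]
  rfl

theorem Jmod_one {I : Ideal B} (hI : ∀ x ∈ I, ∃ a : A, algebraMap A B a = x) :
    Jmod A K (1 : B ⧸ I) = 1 := by
  ext k
  rw [mem_Jmod, Submodule.mem_one]
  constructor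
  · rintro ⟨x, ⟨a, ha⟩, rfl⟩
    rw [mul_one, eq_comm, Ideal.Quotient.eq] at ha
    obtain ⟨a', ha'⟩ := hI _ ha
    refine ⟨a' + a, ?_⟩
    rw [IsScalarTower.algebraMap_apply A B K, map_add, ha', sub_add_cancel]
  · rintro ⟨a, rfl⟩
    exact ⟨algebraMap A B a, ⟨a, mul_one _⟩, (IsScalarTower.algebraMap_apply A B K a).symm⟩

theorem mem_Jmod_of_mem {I : Ideal B} (b : B ⧸ I) {x : B} (hx : x ∈ I) :
    algebraMap B K x ∈ Jmod A K b :=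
  mem_Jmod.2 ⟨x, ⟨0, by simp [Ideal.Quotient.eq_zero_iff_mem.2 hx]⟩, rfl⟩

theorem Jmod_mul {I : Ideal B} (b c : (B ⧸ I)ˣ) :
    Jmod A K (b * c : B ⧸ I) = Jmod A K (b : B ⧸ I) * Jmod A K (c : B ⧸ I) := by
  obtain ⟨β, hβ⟩ := Ideal.Quotient.mk_surjective (b : B ⧸ I)
  obtain ⟨γ, hγ⟩ := Ideal.Quotient.mk_surjective (c : B ⧸ I)
  obtain ⟨γ', hγ'⟩ := Ideal.Quotient.mk_surjective ((c⁻¹ : (B ⧸ I)ˣ) : B ⧸ I)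
  have h1 : 1 - γ * γ' ∈ I := by
    rw [← Ideal.Quotient.eq_zero_iff_mem]; simp [hγ, hγ']
  have hγJ : algebraMap B K γ ∈ Jmod A K (c : B ⧸ I) := mem_Jmod.2 ⟨γ, ⟨1, by simp [hγ]⟩, rfl⟩
  apply le_antisymm
  · intro k hk
    obtain ⟨x, ⟨a, ha⟩, rfl⟩ := mem_Jmod.1 hk
    have hi : x - algebraMap A B a * β * γ ∈ I := by
      rw [← Ideal.Quotient.eq]; simp [← ha, hβ, hγ, mul_assoc]
    set i := x - algebraMap A B a * β * γ with hidef
    have hx : x = (algebraMap A B a * β) * γ + ((i * γ') * γ + i * (1 - γ * γ')) := by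
      rw [hidef]; ring
    rw [hx, map_add, map_add, map_mul _ _ γ, map_mul _ (i * γ') γ, map_mul _ i (1 - γ * γ')]
    refine add_mem (Submodule.mul_mem_mul (mem_Jmod.2 ⟨_, ⟨a, by simp [hβ]⟩, rfl⟩) hγJ)
      (add_mem (Submodule.mul_mem_mul (mem_Jmod_of_mem _ (I.mul_mem_right _ hi)) hγJ)
      (Submodule.mul_mem_mul (mem_Jmod_of_mem _ hi) (mem_Jmod_of_mem _ h1)))
  · rw [Submodule.mul_le]
    intro k hk l hl
    obtain ⟨x, ⟨a, ha⟩, rfl⟩ := mem_Jmod.1 hk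
    obtain ⟨y, ⟨a', ha'⟩, rfl⟩ := mem_Jmod.1 hl
    refine mem_Jmod.2 ⟨x * y, ⟨a * a', ?_⟩, by simp⟩
    simp only [map_mul, ← ha, ← ha']
    ring

variable (A K) in
/-- The homomorphism `b ↦ b A + I`. -/
noncomputable def Jhom {I : Ideal B} (hI : ∀ x ∈ I, ∃ a : A, algebraMap A B a = x) :
    (B ⧸ I)ˣ →* (Submodule A K)ˣ where
  toFun b := ⟨Jmod A K (b : B ⧸ I), Jmod A K ((b⁻¹ : (B ⧸ I)ˣ) : B ⧸ I),
    by rw [← Jmod_mul, Units.mul_inv, Jmod_one hI], by rw [← Jmod_mul, Units.inv_mul, Jmod_one hI]⟩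
  map_one' := Units.ext (Jmod_one hI)
  map_mul' b c := Units.ext (Jmod_mul b c)

theorem Jhom_val {I : Ideal B} (hI : ∀ x ∈ I, ∃ a : A, algebraMap A B a = x) (b : (B ⧸ I)ˣ) :
    (Jhom A K hI b : Submodule A K) = Jmod A K (b : B ⧸ I) := rfl

variable (A K) in
/-- The homomorphism to the class group. -/
noncomputable def Phi {I : Ideal B} (hI : ∀ x ∈ I, ∃ a : A, algebraMap A B a = x) :
    (B ⧸ I)ˣ →* CL A K := (QuotientGroup.mk' _).comp (Jhom A K hI)

variable (A) in
/-- The map from the quotient of the order. -/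
noncomputable abbrev qmap (I : Ideal B) :
    (A ⧸ I.comap (algebraMap A B)) →+* B ⧸ I :=
  Ideal.quotientMap I (algebraMap A B) le_rfl

theorem ker_Phi {I : Ideal B} (hI : ∀ x ∈ I, ∃ a : A, algebraMap A B a = x)
    (hinj : Function.Injective (algebraMap B K)) :
    (Phi A K hI).ker = (Units.map (qmap A I).toMonoidHom).range ⊔
      (Units.map (Ideal.Quotient.mk I).toMonoidHom).range := by
  apply le_antisymm
  · intro b hb
    have hb' : Jhom A K hI b ∈ (prin A K).range := (QuotientGroup.eq_one_iff _).1 hb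
    obtain ⟨k, hk⟩ := hb'
    have hk1 : (k : K) ∈ Jmod A K (b : B ⧸ I) := by
      rw [← Jhom_val hI, ← hk]; exact Submodule.mem_span_singleton_self _
    have hk2 : ((k⁻¹ : Kˣ) : K) ∈ Jmod A K ((b⁻¹ : (B ⧸ I)ˣ) : B ⧸ I) := by
      rw [← Jhom_val hI, map_inv, ← hk, ← map_inv]; exact Submodule.mem_span_singleton_self _
    obtain ⟨x, ⟨a, ha⟩, hx⟩ := mem_Jmod.1 hk1
    obtain ⟨y, ⟨a', ha'⟩, hy⟩ := mem_Jmod.1 hk2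
    have hxy : x * y = 1 := hinj (by rw [map_mul, hx, hy, Units.mul_inv, map_one])
    have haa : Ideal.Quotient.mk I (algebraMap A B a) * Ideal.Quotient.mk I (algebraMap A B a')
        = 1 := by
      have := congrArg (Ideal.Quotient.mk I) hxy
      rw [map_mul, ← ha, ← ha', map_one] at this
      rw [← this]
      have hbb := Units.mul_inv b
      linear_combination (-Ideal.Quotient.mk I (algebraMap A B a) *
        Ideal.Quotient.mk I (algebraMap A B a')) * hbb
    have haa' : Ideal.Quotient.mk (I.comap (algebraMap A B)) a' *
        Ideal.Quotient.mk (I.comap (algebraMap A B)) a = 1 := by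
      apply Ideal.quotientMap_injective (I := I) (f := algebraMap A B)
      rw [map_mul, Ideal.quotientMap_mk, Ideal.quotientMap_mk, map_one, mul_comm, haa]
    have : b = Units.map (qmap A I).toMonoidHom (Units.mkOfMulEqOne _ _ haa') *
        Units.map (Ideal.Quotient.mk I).toMonoidHom (Units.mkOfMulEqOne _ _ hxy) := by
      ext
      change (b : B ⧸ I) = Ideal.Quotient.mk I (algebraMap A B a') * Ideal.Quotient.mk I x
      rw [← ha]
      linear_combination (-(b : B ⧸ I)) * haa
    rw [this]
    exact Subgroup.mul_mem_sup ⟨_, rfl⟩ ⟨_, rfl⟩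
  · rw [sup_le_iff]
    constructor
    · rintro _ ⟨r, rfl⟩
      obtain ⟨α, hα⟩ := Ideal.Quotient.mk_surjective (r : A ⧸ I.comap (algebraMap A B))
      obtain ⟨α', hα'⟩ := Ideal.Quotient.mk_surjective
        ((r⁻¹ : (A ⧸ I.comap (algebraMap A B))ˣ) : A ⧸ I.comap (algebraMap A B))
      have h1 : Ideal.Quotient.mk I (algebraMap A B α') * Ideal.Quotient.mk I (algebraMap A B α)
          = 1 := by
        have := congrArg (qmap A I) (Units.inv_mul r)
        rwa [map_mul, ← hα, ← hα', map_one, Ideal.quotientMap_mk, Ideal.quotientMap_mk] at this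
      refine (QuotientGroup.eq_one_iff _).2 ?_
      refine (?_ : Jhom A K hI _ = 1) ▸ one_mem (prin A K).range
      ext1
      rw [Jhom_val, Units.val_one, ← Jmod_one hI]
      have h2 : ((Units.map (qmap A I).toMonoidHom r : (B ⧸ I)ˣ) : B ⧸ I) =
          Ideal.Quotient.mk I (algebraMap A B α) := by
        change qmap A I r = _
        rw [← hα, Ideal.quotientMap_mk]
      rw [h2]
      ext k
      rw [mem_Jmod, mem_Jmod]
      constructor
      · rintro ⟨x, ⟨a, ha⟩, rfl⟩
        exact ⟨x, ⟨a * α, by simp [← ha]⟩, rfl⟩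
      · rintro ⟨x, ⟨a, ha⟩, rfl⟩
        refine ⟨x, ⟨a * α', ?_⟩, rfl⟩
        rw [map_mul, map_mul, mul_assoc, h1, ha]
    · rintro _ ⟨u, rfl⟩
      refine (QuotientGroup.eq_one_iff _).2 ?_
      refine ⟨Units.map (algebraMap B K).toMonoidHom u, ?_⟩
      ext1
      rw [Jhom_val]
      change Submodule.span A {algebraMap B K u} = Jmod A K (Ideal.Quotient.mk I (u : B))
      ext k
      rw [mem_Jmod, Submodule.mem_span_singleton]
      constructor
      · rintro ⟨a, rfl⟩
        exact ⟨algebraMap A B a * u, ⟨a, by simp⟩,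
          by rw [map_mul, Algebra.smul_def, IsScalarTower.algebraMap_apply A B K]⟩
      · rintro ⟨x, ⟨a, ha⟩, rfl⟩
        rw [← map_mul, eq_comm, Ideal.Quotient.eq] at ha
        obtain ⟨a', ha'⟩ := hI _ (I.mul_mem_right ((u⁻¹ : Bˣ) : B) ha)
        refine ⟨a' + a, ?_⟩
        rw [Algebra.smul_def, IsScalarTower.algebraMap_apply A B K, ← map_mul, map_add, ha']
        congr 1
        linear_combination (x - algebraMap A B a * u) * u.inv_mul

theorem card_ker_Phi {I : Ideal B} (hI : ∀ x ∈ I, ∃ a : A, algebraMap A B a = x)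
    (hinj : Function.Injective (algebraMap B K)) :
    Nat.card (Phi A K hI).ker = Nat.card (A ⧸ I.comap (algebraMap A B))ˣ *
      ((Units.map (qmap A I).toMonoidHom).range.comap
        (Units.map (Ideal.Quotient.mk I).toMonoidHom)).index := by
  rw [Subgroup.index_comap, ← Subgroup.relIndex_sup_left, ← ker_Phi hI hinj]
  have hle : (Units.map (qmap A I).toMonoidHom).range ≤ (Phi A K hI).ker := by
    rw [ker_Phi hI hinj]; exact le_sup_left
  have h1 : Nat.card (A ⧸ I.comap (algebraMap A B))ˣ =
      Nat.card (Units.map (qmap A I).toMonoidHom).range :=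
    Nat.card_congr (MonoidHom.ofInjective
      (Units.map_injective (f := (qmap A I).toMonoidHom) Ideal.quotientMap_injective)).toEquiv
  rw [h1, ← Subgroup.relIndex_bot_left, ← Subgroup.relIndex_bot_left,
    Subgroup.relIndex_mul_relIndex _ _ _ bot_le hle]

theorem extCL_mk (J : (Submodule A K)ˣ) :
    extCL A B K (QuotientGroup.mk J) = QuotientGroup.mk (Units.map (ext A B K) J) := rfl

theorem ext_Jmod {I : Ideal B} (b : (B ⧸ I)ˣ) :
    ext A B K (Jmod A K (b : B ⧸ I)) = 1 := by
  rw [ext_apply]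
  apply le_antisymm
  · rw [Submodule.span_le]
    intro k hk
    obtain ⟨x, -, rfl⟩ := mem_Jmod.1 hk
    exact Submodule.mem_one.2 ⟨x, rfl⟩
  · rw [Submodule.one_le]
    obtain ⟨β, hβ⟩ := Ideal.Quotient.mk_surjective (b : B ⧸ I)
    obtain ⟨β', hβ'⟩ := Ideal.Quotient.mk_surjective ((b⁻¹ : (B ⧸ I)ˣ) : B ⧸ I)
    have h1 : 1 - β' * β ∈ I := by
      rw [← Ideal.Quotient.eq_zero_iff_mem]; simp [hβ, hβ']
    have h2 : (1 : K) = β' • algebraMap B K β + algebraMap B K (1 - β' * β) := by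
      rw [Algebra.smul_def, ← map_mul, ← map_add]; simp
    rw [h2]
    exact add_mem (Submodule.smul_mem _ _
      (Submodule.subset_span (mem_Jmod.2 ⟨β, ⟨1, by simp [hβ]⟩, rfl⟩)))
      (Submodule.subset_span (mem_Jmod_of_mem _ h1))

theorem range_Phi {I : Ideal B} (hI : ∀ x ∈ I, ∃ a : A, algebraMap A B a = x)
    (hinjA : Function.Injective (algebraMap A K))
    (hinj : Function.Injective (algebraMap B K)) [Finite (B ⧸ I)] :
    (Phi A K hI).range = (extCL A B K).ker := by
  apply le_antisymm
  · rintro _ ⟨b, rfl⟩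
    rw [MonoidHom.mem_ker]
    change extCL A B K (QuotientGroup.mk (Jhom A K hI b)) = 1
    rw [extCL_mk, QuotientGroup.eq_one_iff]
    refine (?_ : Units.map (ext A B K) (Jhom A K hI b) = 1) ▸ one_mem (prin B K).range
    ext1
    exact ext_Jmod b
  · intro j hj
    obtain ⟨J₀, rfl⟩ := QuotientGroup.mk_surjective j
    rw [MonoidHom.mem_ker, extCL_mk, QuotientGroup.eq_one_iff] at hj
    obtain ⟨k, hk⟩ := hj
    -- normalise so that the extension is trivial
    set J : (Submodule A K)ˣ := J₀ * prin A K k⁻¹ with hJ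
    have hJ1 : (QuotientGroup.mk J₀ : CL A K) = QuotientGroup.mk J := by
      rw [hJ, QuotientGroup.eq]
      simp only [inv_mul_cancel_left]
      exact ⟨_, rfl⟩
    have hext : Units.map (ext A B K) J = 1 := by
      rw [hJ, map_mul, ← hk, map_inv, map_inv]
      rw [mul_inv_eq_one]
      ext1
      change Submodule.span B {(k : K)} = Submodule.span B (Submodule.span A {(k : K)} : Set K)
      rw [Submodule.span_span_of_tower]
    have hext1 : ext A B K (J : Submodule A K) = 1 := congrArg Units.val hext
    have hext2 : ext A B K ((J⁻¹ : (Submodule A K)ˣ) : Submodule A K) = 1 := by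
      have : Units.map (ext A B K) J⁻¹ = 1 := by rw [map_inv, hext, inv_one]
      exact congrArg Units.val this
    have hB1 : ∀ x ∈ (J : Submodule A K), ∃ b : B, algebraMap B K b = x := fun x hx =>
      Submodule.mem_one.1 (hext1 ▸ Submodule.subset_span hx)
    have hB2 : ∀ x ∈ ((J⁻¹ : (Submodule A K)ˣ) : Submodule A K), ∃ b : B, algebraMap B K b = x :=
      fun x hx => Submodule.mem_one.1 (hext2 ▸ Submodule.subset_span hx)
    have : Finite (A ⧸ I.comap (algebraMap A B)) :=
      Finite.of_injective (qmap A I) Ideal.quotientMap_injective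
    obtain ⟨x, hx, y, hy, a, ha, hac⟩ := exists_mul_eq_one_mod hinjA (I.comap (algebraMap A B))
      (J : Submodule A K) _ (Units.mul_inv J)
    obtain ⟨ξ, hξ⟩ := hB1 x hx
    obtain ⟨η, hη⟩ := hB2 y hy
    have hξη : ξ * η = algebraMap A B a := hinj (by
      rw [map_mul, hξ, hη, ← ha, ← IsScalarTower.algebraMap_apply])
    have hac' : 1 - algebraMap A B a ∈ I := by simpa [Ideal.mem_comap] using hac
    have hunit : Ideal.Quotient.mk I ξ * Ideal.Quotient.mk I η = 1 := by
      rw [← map_mul, hξη, eq_comm, ← map_one (Ideal.Quotient.mk I), Ideal.Quotient.eq]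
      exact hac'
    rw [hJ1]
    refine ⟨Units.mkOfMulEqOne _ _ hunit, ?_⟩
    change (QuotientGroup.mk (Jhom A K hI _) : CL A K) = _
    congr 1
    ext1
    rw [Jhom_val]
    change Jmod A K (Ideal.Quotient.mk I ξ) = _
    have hIJ : ∀ i ∈ I, algebraMap B K i ∈ (J : Submodule A K) := by
      intro i hi
      have h1 : (1 : K) ∈ ext A B K (J : Submodule A K) := by
        rw [hext1]; exact Submodule.mem_one.2 ⟨1, map_one _⟩
      rw [ext_apply] at h1
      have : ∀ z ∈ Submodule.span B ((J : Submodule A K) : Set K), ∀ i ∈ I,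
          algebraMap B K i * z ∈ (J : Submodule A K) := by
        intro z hz
        induction hz using Submodule.span_induction with
        | mem z hz =>
          intro i hi
          obtain ⟨α, rfl⟩ := hI i hi
          rw [← IsScalarTower.algebraMap_apply, ← Algebra.smul_def]
          exact Submodule.smul_mem _ _ hz
        | zero => intro i hi; simp
        | add z w _ _ h1 h2 =>
          intro i hi; rw [mul_add]; exact add_mem (h1 i hi) (h2 i hi)
        | smul b z _ h =>
          intro i hi
          have := h (i * b) (I.mul_mem_right _ hi)
          rwa [map_mul, mul_assoc, ← Algebra.smul_def b] at this
      simpa using this 1 h1 i hi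
    ext k
    rw [mem_Jmod]
    constructor
    · rintro ⟨z, ⟨α, hα⟩, rfl⟩
      rw [← map_mul, eq_comm, Ideal.Quotient.eq] at hα
      have h3 : algebraMap B K z = α • x + algebraMap B K (z - algebraMap A B α * ξ) := by
        rw [Algebra.smul_def, ← hξ, IsScalarTower.algebraMap_apply A B K, ← map_mul, ← map_add]
        congr 1; ring
      rw [h3]
      exact add_mem (Submodule.smul_mem _ _ hx) (hIJ _ hα)
    · intro hkJ
      obtain ⟨κ, rfl⟩ := hB1 k hkJ
      obtain ⟨α, hα⟩ : ∃ α, algebraMap A K α = algebraMap B K κ * y := Submodule.mem_one.1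
        (by rw [← Units.mul_inv J]; exact Submodule.mul_mem_mul hkJ hy)
      have hα' : algebraMap A B α = κ * η := hinj (by
        rw [← IsScalarTower.algebraMap_apply, hα, map_mul, hη])
      refine ⟨κ, ⟨α, ?_⟩, rfl⟩
      rw [hα', map_mul]
      linear_combination (Ideal.Quotient.mk I κ) * hunit

theorem extCL_surjective {I : Ideal B} (hI : ∀ x ∈ I, ∃ a : A, algebraMap A B a = x)
    (hinj : Function.Injective (algebraMap B K)) [Finite (B ⧸ I)] :
    Function.Surjective (extCL A B K) := by
  intro j
  obtain ⟨M, rfl⟩ := QuotientGroup.mk_surjective j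
  obtain ⟨x, hx, y, hy, z, hz, hzI, hz0⟩ : ∃ x ∈ (M : Submodule B K),
      ∃ y ∈ ((M⁻¹ : (Submodule B K)ˣ) : Submodule B K), ∃ z : B,
        algebraMap B K z = x * y ∧ 1 - z ∈ I ∧ z ≠ 0 := by
    obtain ⟨x, hx, y, hy, z, hz, hzI⟩ := exists_mul_eq_one_mod hinj I
      (M : Submodule B K) _ (Units.mul_inv M)
    by_cases hz0 : z = 0
    · have htop : I = ⊤ := (Ideal.eq_top_iff_one _).2 (by simpa [hz0] using hzI)
      obtain ⟨x, hx, hx0⟩ := Submodule.exists_mem_ne_zero_of_ne_bot M.ne_zero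
      obtain ⟨y, hy, hy0⟩ := Submodule.exists_mem_ne_zero_of_ne_bot (M⁻¹).ne_zero
      obtain ⟨z, hz⟩ := Submodule.mem_one.1
        (Units.mul_inv M ▸ Submodule.mul_mem_mul hx hy)
      refine ⟨x, hx, y, hy, z, hz, by simp [htop], ?_⟩
      rintro rfl
      rw [map_zero] at hz
      exact mul_ne_zero hx0 hy0 hz.symm
    · exact ⟨x, hx, y, hy, z, hz, hzI, hz0⟩
  have hZ0 : algebraMap B K z ≠ 0 := by
    rw [← map_zero (algebraMap B K)]; exact hinj.ne hz0
  have hy0 : y ≠ 0 := by rintro rfl; simp [hz] at hZ0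
  -- products of elements of `M` and `M⁻¹` are integral
  have hintegral : ∀ m ∈ (M : Submodule B K), ∀ n ∈ ((M⁻¹ : (Submodule B K)ˣ) : Submodule B K),
      ∃ b : B, algebraMap B K b = m * n := fun m hm n hn =>
    Submodule.mem_one.1 (Units.mul_inv M ▸ Submodule.mul_mem_mul hm hn)
  obtain ⟨i, hi⟩ : ∃ i, i = 1 - z := ⟨_, rfl⟩
  rw [← hi] at hzI
  have hzA : algebraMap B K z ∈ (1 : Submodule A K) := by
    obtain ⟨α, hα⟩ := hI i hzI
    refine Submodule.mem_one.2 ⟨1 - α, ?_⟩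
    rw [IsScalarTower.algebraMap_apply A B K, map_sub, hα, hi]; simp
  have hIA : ∀ j ∈ I, algebraMap B K j ∈ (1 : Submodule A K) := by
    intro j hj
    obtain ⟨α, rfl⟩ := hI j hj
    exact Submodule.mem_one.2 ⟨α, IsScalarTower.algebraMap_apply A B K α⟩
  let J : Submodule A K := 1 ⊓ ((M : Submodule B K).restrictScalars A).map (LinearMap.mulLeft A y)
  let J' : Submodule A K := 1 ⊓
    (((M⁻¹ : (Submodule B K)ˣ) : Submodule B K).restrictScalars A).map (LinearMap.mulLeft A x)
  have hZJ : algebraMap B K z ∈ J := ⟨hzA, x, hx, by rw [hz, mul_comm]; rfl⟩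
  have hZJ' : algebraMap B K z ∈ J' := ⟨hzA, y, hy, by rw [hz]; rfl⟩
  have hJ : ∀ j ∈ I, ∀ m ∈ (M : Submodule B K), algebraMap B K j * (y * m) ∈ J := by
    intro j hj m hm
    obtain ⟨β, hβ⟩ := hintegral m hm y hy
    refine ⟨?_, j • m, Submodule.smul_mem _ _ hm, ?_⟩
    · rw [mul_comm y, ← hβ, ← map_mul]; exact hIA _ (I.mul_mem_right _ hj)
    · rw [LinearMap.mulLeft_apply, Algebra.smul_def]; ring
  have hJ' : ∀ j ∈ I, ∀ n ∈ ((M⁻¹ : (Submodule B K)ˣ) : Submodule B K),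
      algebraMap B K j * (x * n) ∈ J' := by
    intro j hj n hn
    obtain ⟨β, hβ⟩ := hintegral x hx n hn
    refine ⟨?_, j • n, Submodule.smul_mem _ _ hn, ?_⟩
    · rw [← hβ, ← map_mul]; exact hIA _ (I.mul_mem_right _ hj)
    · rw [LinearMap.mulLeft_apply, Algebra.smul_def]; ring
  have hJJ : J * J' = Submodule.span A {algebraMap B K z} := by
    apply le_antisymm
    · rw [Submodule.mul_le]
      rintro k ⟨hk, m, hm, rfl⟩ l ⟨hl, n, hn, rfl⟩
      simp only [LinearMap.mulLeft_apply] at hk hl ⊢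
      obtain ⟨o, ho⟩ := hintegral m hm n hn
      obtain ⟨α, hα⟩ := Submodule.mem_one.1 hk
      obtain ⟨α', hα'⟩ := Submodule.mem_one.1 hl
      have hzo : algebraMap A B (α * α') = z * o := hinj (by
        rw [← IsScalarTower.algebraMap_apply, map_mul, hα, hα', map_mul, hz, ho]; ring)
      obtain ⟨α₂, hα₂⟩ := hI (i * o) (I.mul_mem_right _ hzI)
      refine Submodule.mem_span_singleton.2 ⟨α * α' + α₂, ?_⟩
      rw [Algebra.smul_def, IsScalarTower.algebraMap_apply A B K, map_add, hzo, hα₂]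
      have h5 : z * o + i * o = o := by rw [hi]; ring
      rw [h5, ho, hz]; ring
    · rw [Submodule.span_singleton_le_iff_mem]
      have hw : ∀ w ∈ (M : Submodule B K) * ((M⁻¹ : (Submodule B K)ˣ) : Submodule B K),
          algebraMap B K z * algebraMap B K i * algebraMap B K i * w ∈ J * J' := by
        intro w hw
        induction hw using Submodule.mul_induction_on' with
        | mem_mul_mem m hm n hn =>
          have : algebraMap B K z * algebraMap B K i * algebraMap B K i * (m * n) =
              (algebraMap B K i * (y * m)) * (algebraMap B K i * (x * n)) := by
            rw [hz]; ring
          rw [this]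
          exact Submodule.mul_mem_mul (hJ i hzI m hm) (hJ' i hzI n hn)
        | add w _ w' _ h1 h2 => rw [mul_add]; exact add_mem h1 h2
      have h1 := hw 1 (by rw [Units.mul_inv]; exact Submodule.mem_one.2 ⟨1, map_one _⟩)
      have h2 : algebraMap B K z = algebraMap B K z * algebraMap B K z +
          (algebraMap B K i * (y * x)) * algebraMap B K z +
          algebraMap B K z * algebraMap B K i * algebraMap B K i * 1 := by
        rw [mul_comm y x, ← hz, hi, map_sub, map_one]; ring
      rw [h2]
      exact add_mem (add_mem (Submodule.mul_mem_mul hZJ hZJ')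
        (Submodule.mul_mem_mul (hJ i hzI x hx) hZJ')) h1
  have hunit : J * (J' * Submodule.span A {(algebraMap B K z)⁻¹}) = 1 := by
    rw [← mul_assoc, hJJ, Submodule.span_mul_span, Set.singleton_mul_singleton,
      mul_inv_cancel₀ hZ0, Submodule.one_eq_span]
  have hext : ext A B K J = (M : Submodule B K) * Submodule.span B {y} := by
    rw [ext_apply]
    apply le_antisymm
    · rw [Submodule.span_le]
      rintro k ⟨-, m, hm, rfl⟩
      rw [LinearMap.mulLeft_apply, mul_comm y m]
      exact Submodule.mul_mem_mul hm (Submodule.mem_span_singleton_self _)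
    · rw [Submodule.mul_le]
      intro m hm y' hy'
      obtain ⟨b, rfl⟩ := Submodule.mem_span_singleton.1 hy'
      obtain ⟨β, hβ⟩ := hintegral m hm y hy
      have : m * b • y = b • (β • algebraMap B K z + algebraMap B K i * (y * m)) := by
        rw [mul_smul_comm, Algebra.smul_def β, hβ, hi, map_sub, map_one]
        congr 1; ring
      rw [this]
      exact Submodule.smul_mem _ _ (add_mem (Submodule.smul_mem _ _ (Submodule.subset_span hZJ))
        (Submodule.subset_span (hJ i hzI m hm)))
  refine ⟨QuotientGroup.mk (Units.mkOfMulEqOne _ _ hunit), ?_⟩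
  rw [extCL_mk, eq_comm, QuotientGroup.eq]
  refine ⟨Units.mk0 y hy0, ?_⟩
  rw [eq_inv_mul_iff_mul_eq]
  ext1
  exact hext.symm

theorem main {I : Ideal B} (hI : ∀ x ∈ I, ∃ a : A, algebraMap A B a = x)
    (hinjA : Function.Injective (algebraMap A K))
    (hinj : Function.Injective (algebraMap B K)) [Finite (B ⧸ I)] :
    Nat.card (CL A K) * Nat.card (A ⧸ I.comap (algebraMap A B))ˣ *
      ((Units.map (qmap A I).toMonoidHom).range.comap
        (Units.map (Ideal.Quotient.mk I).toMonoidHom)).index =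
    Nat.card (CL B K) * Nat.card (B ⧸ I)ˣ := by
  have h1 := Subgroup.card_mul_index (extCL A B K).ker
  rw [Subgroup.index_ker, MonoidHom.range_eq_top.2 (extCL_surjective hI hinj),
    Nat.card_congr Subgroup.topEquiv.toEquiv, ← range_Phi hI hinjA hinj] at h1
  have h2 := Subgroup.card_mul_index (Phi A K hI).ker
  rw [Subgroup.index_ker, card_ker_Phi hI hinj] at h2
  rw [← h1, ← h2]; ring

end generic

section instantiate

variable {K : Type*} [Field K] [NumberField K] (R : Subring (𝓞 K))

theorem exists_nat (hR : Finite ((𝓞 K) ⧸ R.toAddSubgroup)) :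
    ∃ n : ℕ, n ≠ 0 ∧ (n : 𝓞 K) ∈ conductorIdeal R := by
  refine ⟨Nat.card ((𝓞 K) ⧸ R.toAddSubgroup), Nat.card_pos.ne', fun y => ?_⟩
  have : (Nat.card ((𝓞 K) ⧸ R.toAddSubgroup)) • (QuotientAddGroup.mk y : (𝓞 K) ⧸ R.toAddSubgroup)
      = 0 := card_nsmul_eq_zero'
  rw [← QuotientAddGroup.mk_nsmul, QuotientAddGroup.eq_zero_iff, nsmul_eq_mul] at this
  exact this

theorem isFractionRing (hR : Finite ((𝓞 K) ⧸ R.toAddSubgroup)) : IsFractionRing R K := by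
  have hinj : Function.Injective (algebraMap R K) :=
    (FaithfulSMul.algebraMap_injective (𝓞 K) K).comp Subtype.val_injective
  have : FaithfulSMul R K := (faithfulSMul_iff_algebraMap_injective R K).2 hinj
  obtain ⟨n, hn, hnI⟩ := exists_nat R hR
  refine IsFractionRing.of_field R K fun k => ?_
  obtain ⟨x, y, hy, rfl⟩ := IsFractionRing.div_surjective (A := 𝓞 K) k
  refine ⟨⟨n * x, hnI x⟩, ⟨n * y, hnI y⟩, ?_⟩
  change _ = algebraMap (𝓞 K) K (n * x) / algebraMap (𝓞 K) K (n * y)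
  have : (n : K) ≠ 0 := by exact_mod_cast hn
  rw [map_mul, map_mul, map_natCast, mul_div_mul_left _ _ this]

theorem mem_R_of_mem {x : 𝓞 K} (hx : x ∈ conductorIdeal R) : x ∈ R := by
  simpa using hx 1

theorem comap_eq : (Units.map (qmap R (conductorIdeal R)).toMonoidHom).range.comap
    (Units.map (Ideal.Quotient.mk (conductorIdeal R)).toMonoidHom) = unitsInOrder R := by
  have key : ∀ (u : (𝓞 K)ˣ), u ∈ (Units.map (qmap R (conductorIdeal R)).toMonoidHom).range.comap
    (Units.map (Ideal.Quotient.mk (conductorIdeal R)).toMonoidHom) → (u : 𝓞 K) ∈ R := by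
    rintro u ⟨r, hr⟩
    obtain ⟨α, hα⟩ := Ideal.Quotient.mk_surjective
      (r : R ⧸ (conductorIdeal R).comap (algebraMap R (𝓞 K)))
    have h1 : qmap R (conductorIdeal R) r = Ideal.Quotient.mk (conductorIdeal R) (u : 𝓞 K) :=
      congrArg Units.val hr
    rw [← hα, Ideal.quotientMap_mk, eq_comm, Ideal.Quotient.eq] at h1
    have h2 := R.add_mem (mem_R_of_mem R h1) α.2
    have h3 : (u : 𝓞 K) - algebraMap R (𝓞 K) α + (α : 𝓞 K) = u := sub_add_cancel _ _
    rwa [h3] at h2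
  ext u
  constructor
  · intro hu
    exact ⟨key u hu, key u⁻¹ (inv_mem hu)⟩
  · rintro ⟨h1, h2⟩
    let v : Rˣ := ⟨⟨u, h1⟩, ⟨_, h2⟩, Subtype.ext u.mul_inv, Subtype.ext u.inv_mul⟩
    refine ⟨Units.map (Ideal.Quotient.mk _).toMonoidHom v, ?_⟩
    ext1
    rfl

end instantiate
end OrderClassNumber

/-- The class number formula for an order `R` in a number field `K` with conductor `I`:
`|Cl(R)| · |U(R/(I∩R))| · |U(𝓞_K)/U(R)| = |Cl(𝓞_K)| · |U(𝓞_K/I)|`. -/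
theorem stmt_4 {K : Type*} [Field K] [NumberField K] (R : Subring (𝓞 K))
    (hR : Finite ((𝓞 K) ⧸ R.toAddSubgroup)) :
    Nat.card (ClassGroup R) *
      Nat.card (R ⧸ Ideal.comap R.subtype (conductorIdeal R))ˣ *
      Nat.card ((𝓞 K)ˣ ⧸ unitsInOrder R) =
    Nat.card (ClassGroup (𝓞 K)) * Nat.card ((𝓞 K) ⧸ conductorIdeal R)ˣ := by
  have hfrac : IsFractionRing R K := OrderClassNumber.isFractionRing R hR
  obtain ⟨n, hn, hnI⟩ := OrderClassNumber.exists_nat R hR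
  have hne : conductorIdeal R ≠ ⊥ := by
    intro h
    rw [h, Ideal.mem_bot] at hnI
    exact hn (by exact_mod_cast hnI)
  have : Finite ((𝓞 K) ⧸ conductorIdeal R) := Ideal.finiteQuotientOfFreeOfNeBot _ hne
  have hmain := OrderClassNumber.main (A := R) (B := 𝓞 K) (K := K) (I := conductorIdeal R)
    (fun x hx => ⟨⟨x, OrderClassNumber.mem_R_of_mem R hx⟩, rfl⟩)
    (IsFractionRing.injective R K) (IsFractionRing.injective (𝓞 K) K)
  rw [OrderClassNumber.comap_eq] at hmain
  rw [OrderClassNumber.card_classGroup R K, OrderClassNumber.card_classGroup (𝓞 K) K]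
  exact hmain
end

section
/- Let R be an order in a number field K whose conductor P is a prime ideal of 𝓞_K. Let D ∈ ℕ be such that every multiset of D elements of Cl(R) has a nonempty submultiset whose sum is zero. If α ∈ R is irreducible in R and S is a multiset of prime ideals of 𝓞_K whose product equals the ideal α𝓞_K, then the cardinality of S is at most D. -/
set_option synthInstance.maxHeartbeats 1000000
set_option maxHeartbeats 1000000

open NumberField

section helpers
open nonZeroDivisors

variable {K : Type*} [Field K] [NumberField K] (R : Subring (𝓞 K))

lemma exists_le_of_le_map {A B : Type*} (g : A → B) (s : Multiset A) (t : Multiset B)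
    (h : t ≤ s.map g) : ∃ u ≤ s, u.map g = t := by
  classical
  induction s using Multiset.induction_on generalizing t with
  | empty => exact ⟨0, le_rfl, by simpa using (Multiset.le_zero.mp (by simpa using h)).symm⟩
  | cons a s ih =>
    rw [Multiset.map_cons] at h
    by_cases hm : g a ∈ t
    · obtain ⟨t', rfl⟩ := Multiset.exists_cons_of_mem hm
      obtain ⟨u, hu, rfl⟩ := ih t' ((Multiset.cons_le_cons_iff _).mp h)
      exact ⟨a ::ₘ u, (Multiset.cons_le_cons_iff _).mpr hu, by simp⟩
    · obtain ⟨u, hu, rfl⟩ := ih t ((Multiset.le_cons_of_notMem hm).mp h)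
      exact ⟨u, hu.trans (Multiset.le_cons_self _ _), rfl⟩

lemma exists_le_card_eq' {A : Type*} (s : Multiset A) {n : ℕ} (h : n ≤ Multiset.card s) :
    ∃ u ≤ s, Multiset.card u = n := by
  induction s using Quotient.inductionOn with
  | h l =>
    refine ⟨(l.take n : List A), ?_, ?_⟩
    · exact Multiset.coe_le.mpr (List.take_sublist n l).subperm
    · simpa using h

lemma cond_mem {x : 𝓞 K} (hx : x ∈ conductorIdeal R) : x ∈ R := by
  simpa using hx 1

lemma cond_ne_bot (hR : Finite ((𝓞 K) ⧸ R.toAddSubgroup)) : conductorIdeal R ≠ ⊥ := by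
  intro h
  have hn : Nat.card ((𝓞 K) ⧸ R.toAddSubgroup) ≠ 0 := Nat.card_pos.ne'
  have : ((Nat.card ((𝓞 K) ⧸ R.toAddSubgroup) : ℕ) : 𝓞 K) ∈ conductorIdeal R := by
    intro y
    rw [← nsmul_eq_mul]
    have h2 : Nat.card ((𝓞 K) ⧸ R.toAddSubgroup) • (y : (𝓞 K) ⧸ R.toAddSubgroup) = 0 :=
      card_nsmul_eq_zero'
    rw [← QuotientAddGroup.mk_nsmul, QuotientAddGroup.eq_zero_iff] at h2
    exact h2
  rw [h, Ideal.mem_bot] at this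
  exact hn (by exact_mod_cast this)

lemma exists_pow_sub_one (P : Ideal (𝓞 K)) (hP : P.IsPrime) (hb : P ≠ ⊥) (b : 𝓞 K) (h : b ∉ P) :
    ∃ n : ℕ, 0 < n ∧ b ^ n - 1 ∈ P := by
  have hm : P.IsMaximal := hP.isMaximal hb
  have hf : Finite (𝓞 K ⧸ P) := Ideal.finiteQuotientOfFreeOfNeBot P hb
  letI := Ideal.Quotient.field P
  have hne : (Ideal.Quotient.mk P b) ≠ 0 := by rwa [Ne, Ideal.Quotient.eq_zero_iff_mem]
  obtain ⟨n, hn, hn1⟩ := (isOfFinOrder_of_finite (Units.mk0 _ hne)).exists_pow_eq_one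
  refine ⟨n, hn, ?_⟩
  rw [← Ideal.Quotient.eq_zero_iff_mem]
  have := congrArg Units.val hn1
  simp at this
  simp [this]

lemma mem_of_mul (hR : Finite ((𝓞 K) ⧸ R.toAddSubgroup)) (hP : (conductorIdeal R).IsPrime)
    {a y : 𝓞 K} (ha : a ∈ R) (haP : a ∉ conductorIdeal R) (h : a * y ∈ R) : y ∈ R := by
  obtain ⟨n, hn, h1⟩ := exists_pow_sub_one _ hP (cond_ne_bot R hR) a haP
  obtain ⟨m, rfl⟩ := Nat.exists_eq_succ_of_ne_zero hn.ne'
  have h2 : y = a ^ m * (a * y) - (a ^ (m+1) - 1) * y := by ring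
  rw [h2]
  exact R.sub_mem (R.mul_mem (R.pow_mem ha m) h) (h1 y)

lemma coprime_split {J : Ideal (𝓞 K)} (hJ : IsCoprime J (conductorIdeal R)) :
    ∃ j : R, (j : 𝓞 K) ∈ J ∧ 1 - (j : 𝓞 K) ∈ conductorIdeal R := by
  obtain ⟨j, hj, p, hp, h⟩ := Ideal.isCoprime_iff_exists.mp hJ
  have e : j = 1 - p := by rw [← h]; ring
  refine ⟨⟨j, ?_⟩, hj, ?_⟩
  · rw [e]; exact R.sub_mem R.one_mem (cond_mem R hp)
  · simp only [e]; simpa using hp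

lemma map_comap_coprime {J : Ideal (𝓞 K)} (hJ : IsCoprime J (conductorIdeal R)) :
    (J.comap R.subtype).map R.subtype = J := by
  apply le_antisymm Ideal.map_comap_le
  intro x hx
  obtain ⟨j, hj, hp⟩ := coprime_split R hJ
  have e : x = x * j + x * (1 - j) := by ring
  rw [e]
  refine Ideal.add_mem _ (Ideal.mul_mem_left _ _ (Ideal.mem_map_of_mem R.subtype (x := j) hj)) ?_
  have hm : x * (1 - j) ∈ R := cond_mem R (Ideal.mul_mem_left _ _ hp)
  have hmem : (⟨_, hm⟩ : R) ∈ J.comap R.subtype :=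
    show x * (1 - j) ∈ J from Ideal.mul_mem_right _ _ hx
  exact Ideal.mem_map_of_mem R.subtype hmem

lemma comap_map_coprime {I : Ideal R} (i : R) (hi : i ∈ I)
    (hp : 1 - (i : 𝓞 K) ∈ conductorIdeal R) :
    (I.map R.subtype).comap R.subtype = I := by
  refine le_antisymm ?_ Ideal.le_comap_map
  intro x hx
  have key : ∀ z ∈ I.map R.subtype, ∀ p ∈ conductorIdeal R, ∃ w ∈ I, (w : 𝓞 K) = z * p := by
    intro z hz
    refine Submodule.span_induction ?_ ?_ ?_ ?_ hz
    · rintro _ ⟨a, ha, rfl⟩ p hp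
      exact ⟨a * ⟨p, cond_mem R hp⟩, Ideal.mul_mem_right _ _ ha, by simp⟩
    · intro p hp
      exact ⟨0, I.zero_mem, by simp⟩
    · intro a b _ _ ha hb p hp
      obtain ⟨u, hu, hu'⟩ := ha p hp
      obtain ⟨v, hv, hv'⟩ := hb p hp
      exact ⟨u + v, I.add_mem hu hv, by push_cast; rw [hu', hv']; ring⟩
    · intro c a _ ha p hp
      obtain ⟨u, hu, hu'⟩ := ha (c * p) (Ideal.mul_mem_left _ _ hp)
      exact ⟨u, hu, by rw [hu', smul_eq_mul]; ring⟩
  obtain ⟨w, hw, hw'⟩ := key x hx _ hp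
  have e : x = x * i + w := by
    apply Subtype.ext
    push_cast
    rw [hw']; ring
  rw [e]
  exact I.add_mem (Ideal.mul_mem_left _ _ hi) hw

lemma comap_mul_coprime {J J' : Ideal (𝓞 K)} (hJ : IsCoprime J (conductorIdeal R))
    (hJ' : IsCoprime J' (conductorIdeal R)) :
    (J * J').comap R.subtype = J.comap R.subtype * J'.comap R.subtype := by
  obtain ⟨j, hj, hp⟩ := coprime_split R hJ
  obtain ⟨j', hj', hp'⟩ := coprime_split R hJ'
  have := comap_map_coprime R (I := J.comap R.subtype * J'.comap R.subtype) (j * j')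
    (Ideal.mul_mem_mul hj hj') (by
      have e : 1 - ((j * j' : R) : 𝓞 K) = (1 - j) + j * (1 - j') := by push_cast; ring
      rw [e]
      exact Ideal.add_mem _ hp (Ideal.mul_mem_left _ _ hp'))
  rw [Ideal.map_mul, map_comap_coprime R hJ, map_comap_coprime R hJ'] at this
  exact this

lemma comap_pow_coprime {J : Ideal (𝓞 K)} (hJ : IsCoprime J (conductorIdeal R)) (n : ℕ) :
    (J ^ n).comap R.subtype = (J.comap R.subtype) ^ n := by
  induction n with
  | zero => simp [Ideal.one_eq_top]
  | succ n ih => rw [pow_succ, pow_succ, comap_mul_coprime R hJ.pow_left hJ, ih]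

lemma coprime_prod (T : Multiset (Ideal (𝓞 K))) (h : ∀ J ∈ T, IsCoprime J (conductorIdeal R)) :
    IsCoprime T.prod (conductorIdeal R) := by
  induction T using Multiset.induction_on with
  | empty =>
    rw [Multiset.prod_zero]
    exact isCoprime_one_left
  | cons a s ih =>
    rw [Multiset.prod_cons]
    exact (h a (Multiset.mem_cons_self _ _)).mul_left
      (ih fun J hJ => h J (Multiset.mem_cons_of_mem hJ))

lemma pow_card_principal (J : Ideal (𝓞 K)) (hJ : J ≠ ⊥) :
    ∃ n : ℕ, 0 < n ∧ (J ^ n).IsPrincipal := by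
  have hJ0 : J ∈ (Ideal (𝓞 K))⁰ := mem_nonZeroDivisors_of_ne_zero hJ
  obtain ⟨n, hn, hn1⟩ := (isOfFinOrder_of_finite (ClassGroup.mk0 ⟨J, hJ0⟩)).exists_pow_eq_one
  refine ⟨n, hn, ?_⟩
  rw [← ClassGroup.mk0_eq_one_iff (pow_mem hJ0 n), ← hn1, ← map_pow]
  rfl

lemma isUnit_comap (hR : Finite ((𝓞 K) ⧸ R.toAddSubgroup)) (hP : (conductorIdeal R).IsPrime)
    {J : Ideal (𝓞 K)} (hJ : IsCoprime J (conductorIdeal R)) :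
    IsUnit ((J.comap R.subtype : Ideal R) : FractionalIdeal R⁰ (FractionRing R)) := by
  have hJ0 : J ≠ ⊥ := by
    rintro rfl
    apply hP.ne_top
    obtain ⟨j, hj, hp⟩ := coprime_split R hJ
    rw [Ideal.eq_top_iff_one]
    rw [Ideal.mem_bot] at hj
    simpa [hj] using hp
  obtain ⟨h, hh, hpr⟩ := pow_card_principal J hJ0
  obtain ⟨b, hb⟩ := hpr
  rw [← Ideal.span] at hb
  have hbP : b ∉ conductorIdeal R := by
    intro hbP
    have hc : IsCoprime (J ^ h) (conductorIdeal R) := hJ.pow_left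
    obtain ⟨j, hj, hp⟩ := coprime_split R hc
    rw [hb] at hj
    have := (Ideal.span_singleton_le_iff_mem _).mpr hbP hj
    apply hP.ne_top
    rw [Ideal.eq_top_iff_one]
    simpa using Ideal.add_mem _ hp this
  obtain ⟨n, hn, h1⟩ := exists_pow_sub_one _ hP (cond_ne_bot R hR) b hbP
  have haR : b ^ n ∈ R := by
    have := R.add_mem (cond_mem R h1) R.one_mem
    simpa using this
  have haP : b ^ n ∉ conductorIdeal R := fun h => hbP (hP.mem_of_pow_mem _ h)
  have e : (J.comap R.subtype) ^ (h * n) = Ideal.span {(⟨b ^ n, haR⟩ : R)} := by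
    rw [← comap_pow_coprime R hJ, pow_mul, hb, Ideal.span_singleton_pow]
    ext x
    rw [Ideal.mem_comap, Ideal.mem_span_singleton, Ideal.mem_span_singleton]
    constructor
    · rintro ⟨y, hy⟩
      have hy' : (x : 𝓞 K) = b ^ n * y := hy
      have : y ∈ R := mem_of_mul R hR hP haR haP (hy' ▸ x.2)
      exact ⟨⟨y, this⟩, Subtype.ext hy'⟩
    · rintro ⟨y, rfl⟩
      exact ⟨y, rfl⟩
  rw [← isUnit_pow_iff (Nat.mul_pos hh hn).ne', ← FractionalIdeal.coeIdeal_pow, e,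
    FractionalIdeal.coeIdeal_span_singleton]
  have hne : algebraMap R (FractionRing R) ⟨b ^ n, haR⟩ ≠ 0 := by
    rw [Ne, FaithfulSMul.algebraMap_eq_zero_iff]
    intro h0
    apply haP
    rw [show b ^ n = 0 from congrArg Subtype.val h0]
    exact zero_mem _
  refine IsUnit.of_mul_eq_one (FractionalIdeal.spanSingleton _
    (algebraMap R (FractionRing R) ⟨b ^ n, haR⟩)⁻¹) ?_
  rw [FractionalIdeal.spanSingleton_mul_spanSingleton, mul_inv_cancel₀ hne,
    FractionalIdeal.spanSingleton_one]

lemma exists_cls (hR : Finite ((𝓞 K) ⧸ R.toAddSubgroup)) (hP : (conductorIdeal R).IsPrime) :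
    ∃ cls : Ideal (𝓞 K) → ClassGroup R, ∀ T : Multiset (Ideal (𝓞 K)),
      (∀ J ∈ T, IsCoprime J (conductorIdeal R)) → (T.map cls).prod = 1 →
      (T.prod.comap R.subtype).IsPrincipal := by
  classical
  let U : Ideal (𝓞 K) → (FractionalIdeal R⁰ (FractionRing R))ˣ := fun J =>
    if h : IsCoprime J (conductorIdeal R) then (isUnit_comap R hR hP h).unit else 1
  have hU : ∀ J, IsCoprime J (conductorIdeal R) → ((U J : (FractionalIdeal R⁰ (FractionRing R))ˣ) :
      FractionalIdeal R⁰ (FractionRing R)) = (J.comap R.subtype : Ideal R) := by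
    intro J h
    simp only [U, dif_pos h]
    rfl
  refine ⟨fun J => ClassGroup.mk (R := R) (K := FractionRing R) (U J), fun T hT h1 => ?_⟩
  have h2 : ClassGroup.mk (R := R) (K := FractionRing R) (T.map U).prod = 1 := by
    rw [map_multiset_prod, Multiset.map_map]
    exact h1
  have h3 : (((T.map U).prod : (FractionalIdeal R⁰ (FractionRing R))ˣ) :
      FractionalIdeal R⁰ (FractionRing R)) = (T.prod.comap R.subtype : Ideal R) := by
    clear h1 h2
    induction T using Multiset.induction_on with
    | empty => simp [Ideal.one_eq_top]
    | cons a s ih =>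
      have hs : ∀ J ∈ s, IsCoprime J (conductorIdeal R) :=
        fun J hJ => hT J (Multiset.mem_cons_of_mem hJ)
      have ha := hT a (Multiset.mem_cons_self _ _)
      rw [Multiset.map_cons, Multiset.prod_cons, Multiset.prod_cons, Units.val_mul, ih hs,
        hU a ha, comap_mul_coprime R ha (coprime_prod R s hs), FractionalIdeal.coeIdeal_mul]
  rw [ClassGroup.mk_eq_one_iff, h3, FractionalIdeal.coe_coeIdeal] at h2
  exact (IsFractionRing.coeSubmodule_isPrincipal (R := R) (K := FractionRing R)).1 h2

/-- Equality of ideal classes. -/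
def IdRel (I J : Ideal (𝓞 K)) : Prop :=
  ∃ x y : 𝓞 K, x ≠ 0 ∧ y ≠ 0 ∧ Ideal.span {x} * I = Ideal.span {y} * J

lemma IdRel.prod (f : Ideal (𝓞 K) → Ideal (𝓞 K)) (T : Multiset (Ideal (𝓞 K)))
    (h : ∀ Q ∈ T, IdRel Q (f Q)) : IdRel T.prod (T.map f).prod := by
  induction T using Multiset.induction_on with
  | empty => exact ⟨1, 1, one_ne_zero, one_ne_zero, by simp⟩
  | cons a s ih =>
    obtain ⟨x, y, hx, hy, e⟩ := h a (Multiset.mem_cons_self _ _)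
    obtain ⟨x', y', hx', hy', e'⟩ := ih fun J hJ => h J (Multiset.mem_cons_of_mem hJ)
    refine ⟨x * x', y * y', mul_ne_zero hx hx', mul_ne_zero hy hy', ?_⟩
    rw [Multiset.map_cons, Multiset.prod_cons, Multiset.prod_cons,
      ← Ideal.span_singleton_mul_span_singleton, ← Ideal.span_singleton_mul_span_singleton,
      mul_mul_mul_comm, e, e', mul_mul_mul_comm]

lemma IdRel.principal {I J : Ideal (𝓞 K)} (h : IdRel I J) (b : 𝓞 K) (hJ : J = Ideal.span {b}) :
    ∃ c, I = Ideal.span {c} := by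
  obtain ⟨x, y, hx, hy, e⟩ := h
  rw [hJ, Ideal.span_singleton_mul_span_singleton] at e
  have h1 : y * b ∈ Ideal.span {x} := by
    have : y * b ∈ Ideal.span {x} * I := by
      rw [e]
      exact Ideal.mem_span_singleton_self _
    exact (Ideal.mul_le_left : Ideal.span {x} * I ≤ Ideal.span {x}) this
  obtain ⟨z, hz⟩ := Ideal.mem_span_singleton.mp h1
  refine ⟨z, ?_⟩
  rw [hz, ← Ideal.span_singleton_mul_span_singleton] at e
  exact mul_left_cancel₀ (by simpa using hx) e

lemma exists_coprime_rel (P : Ideal (𝓞 K)) (hP : P.IsPrime) (hb : P ≠ ⊥) :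
    ∃ P', IsCoprime P' P ∧ IdRel P P' := by
  have hm : P.IsMaximal := hP.isMaximal hb
  have hlt : P ^ 2 < P := by
    have := Ideal.pow_right_strictAnti P hb hP.ne_top (show 1 < 2 by norm_num)
    simpa using this
  obtain ⟨t, ht, ht2⟩ := SetLike.exists_of_lt hlt
  obtain ⟨J, hJ⟩ := Ideal.dvd_iff_le.mpr ((Ideal.span_singleton_le_iff_mem _).mpr ht)
  have ht0 : t ≠ 0 := by rintro rfl; exact ht2 (zero_mem _)
  have hJP : IsCoprime J P := by
    rw [isCoprime_comm, Ideal.isCoprime_iff_sup_eq]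
    by_contra hne
    have hle : J ≤ P := by
      have h1 : P ⊔ J = P := (hm.eq_of_le hne le_sup_left).symm
      exact h1 ▸ le_sup_right
    apply ht2
    rw [pow_two]
    exact Ideal.mul_mono_right hle (hJ ▸ Ideal.mem_span_singleton_self t)
  have hJ0 : J ≠ ⊥ := by
    rintro rfl
    apply ht0
    simpa using hJ
  obtain ⟨n, hn, b, hbn⟩ := pow_card_principal J hJ0
  rw [← Ideal.span] at hbn
  obtain ⟨m, rfl⟩ := Nat.exists_eq_succ_of_ne_zero hn.ne'
  refine ⟨J ^ m, hJP.pow_left, b, t, ?_, ht0, ?_⟩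
  · rintro rfl
    apply pow_ne_zero (m+1) hJ0
    rw [hbn]; simp
  · rw [← hbn, hJ, pow_succ]; ring

end helpers

theorem stmt_8 {K : Type*} [Field K] [NumberField K] (R : Subring (𝓞 K))
    (hR : Finite ((𝓞 K) ⧸ R.toAddSubgroup))
    (hP : (conductorIdeal R).IsPrime)
    (D : ℕ)
    (hD : ∀ S : Multiset (ClassGroup R), Multiset.card S = D →
      ∃ T ≤ S, T ≠ 0 ∧ T.prod = 1)
    (α : R) (hα : Irreducible α)
    (S : Multiset (Ideal (𝓞 K))) (hSprime : ∀ P ∈ S, P.IsPrime)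
    (hSprod : S.prod = Ideal.span {(α : 𝓞 K)}) :
    Multiset.card S ≤ D := by
  classical
  by_contra! hlt
  have hb := cond_ne_bot R hR
  set P := conductorIdeal R with hPdef
  have hm : P.IsMaximal := hP.isMaximal hb
  have hα0 : (α : 𝓞 K) ≠ 0 := by
    intro h; exact hα.ne_zero (Subtype.ext h)
  have hSne : ∀ Q ∈ S, Q ≠ ⊥ := by
    rintro Q hQ rfl
    rw [Multiset.prod_eq_zero hQ] at hSprod
    exact hα0 (by simpa using hSprod.symm)
  obtain ⟨P', hP'c, hP'r⟩ := exists_coprime_rel P hP hb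
  obtain ⟨cls, hcls⟩ := exists_cls R hR hP
  let f : Ideal (𝓞 K) → Ideal (𝓞 K) := fun Q => if Q = P then P' else Q
  have hfc : ∀ Q ∈ S, IsCoprime (f Q) P := by
    intro Q hQ
    by_cases h : Q = P
    · simpa [f, h] using hP'c
    · simp only [f, if_neg h]
      have hQm : Q.IsMaximal := (hSprime Q hQ).isMaximal (hSne Q hQ)
      rw [Ideal.isCoprime_iff_sup_eq]
      exact hQm.coprime_of_ne hm h
  have hfr : ∀ Q, IdRel Q (f Q) := by
    intro Q
    by_cases h : Q = P
    · simpa [f, h] using hP'r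
    · simp only [f, if_neg h]
      exact ⟨1, 1, one_ne_zero, one_ne_zero, rfl⟩
  -- the element to omit
  obtain ⟨Q₀, hQ₀, hQ₀P⟩ : ∃ Q₀ ∈ S, P ∈ S → Q₀ = P := by
    by_cases h : P ∈ S
    · exact ⟨P, h, fun _ => rfl⟩
    · obtain ⟨Q, hQ⟩ := Multiset.card_pos_iff_exists_mem.mp (Nat.zero_lt_of_lt hlt)
      exact ⟨Q, hQ, fun h' => absurd h' h⟩
  obtain ⟨S', rfl⟩ := Multiset.exists_cons_of_mem hQ₀
  have hcard : D ≤ Multiset.card S' := by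
    rw [Multiset.card_cons] at hlt; omega
  obtain ⟨S'', hS'', hS''c⟩ := exists_le_card_eq' S' hcard
  obtain ⟨T', hT', hT'0, hT'1⟩ := hD (S''.map fun Q => cls (f Q)) (by simpa using hS''c)
  obtain ⟨T, hT, rfl⟩ : ∃ T ≤ S'', T.map (fun Q => cls (f Q)) = T' :=
    exists_le_of_le_map _ _ _ hT'
  have hT0 : T ≠ 0 := by rintro rfl; simp at hT'0
  obtain ⟨V, rfl⟩ := Multiset.le_iff_exists_add.mp (hT.trans hS'')
  have hTmem : ∀ Q ∈ T, Q ∈ Q₀ ::ₘ (T + V) := fun Q hQ => by simp [hQ]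
  have hpr := hcls (T.map f) (by
    intro J hJ
    obtain ⟨Q, hQ, rfl⟩ := Multiset.mem_map.mp hJ
    exact hfc Q (hTmem Q hQ)) (by rw [Multiset.map_map]; exact hT'1)
  obtain ⟨β₀, hβ₀⟩ := hpr
  rw [← Ideal.span] at hβ₀
  have hβ₀' : (T.map f).prod = Ideal.span {(β₀ : 𝓞 K)} := by
    have := map_comap_coprime R (J := (T.map f).prod) (coprime_prod R _ (by
      intro J hJ
      obtain ⟨Q, hQ, rfl⟩ := Multiset.mem_map.mp hJ
      exact hfc Q (hTmem Q hQ)))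
    rw [hβ₀, Ideal.map_span, Set.image_singleton] at this
    exact this.symm
  -- a generator of `T.prod` lying in `R`
  obtain ⟨β, hβ⟩ : ∃ β : R, T.prod = Ideal.span {(β : 𝓞 K)} := by
    by_cases h : P ∈ T
    · obtain ⟨c, hc⟩ := (IdRel.prod f T fun Q _ => hfr Q).principal _ hβ₀'
      have hcP : c ∈ P := by
        have : T.prod ≤ P := Ideal.dvd_iff_le.mp (Multiset.dvd_prod h)
        exact this (hc ▸ Ideal.mem_span_singleton_self c)
      exact ⟨⟨c, cond_mem R hcP⟩, hc⟩
    · refine ⟨β₀, ?_⟩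
      rw [← hβ₀', Multiset.map_congr rfl (g := id), Multiset.map_id]
      intro Q hQ
      have : Q ≠ P := by rintro rfl; exact h hQ
      simp [f, this]
  have hprod : Ideal.span {(α : 𝓞 K)} = Ideal.span {(β : 𝓞 K)} * (Q₀ * V.prod) := by
    rw [← hSprod, ← hβ, Multiset.prod_cons, Multiset.prod_add]; ring
  have hβ0 : (β : 𝓞 K) ≠ 0 := by
    intro h
    rw [h] at hprod
    exact hα0 (by simpa using hprod)
  obtain ⟨γ, hγ⟩ : (β : 𝓞 K) ∣ α := by
    rw [← Ideal.span_singleton_le_span_singleton (α := 𝓞 K), hprod]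
    exact (Ideal.mul_le_left : Ideal.span {(β : 𝓞 K)} * (Q₀ * V.prod) ≤ _)
  have hγ' : Ideal.span {γ} = Q₀ * V.prod := by
    rw [hγ, ← Ideal.span_singleton_mul_span_singleton] at hprod
    exact mul_left_cancel₀ (by simpa using hβ0) hprod
  have hγQ : γ ∈ Q₀ := by
    have : Ideal.span {γ} ≤ Q₀ := hγ' ▸ Ideal.mul_le_left
    exact this (Ideal.mem_span_singleton_self γ)
  have hγR : γ ∈ R := by
    by_cases h : P ∈ Q₀ ::ₘ (T + V)
    · rw [hQ₀P h] at hγQ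
      exact cond_mem R hγQ
    · refine mem_of_mul R hR hP β.2 ?_ (hγ ▸ α.2)
      intro hβP
      have : T.prod ≤ P := by
        rw [hβ]; exact (Ideal.span_singleton_le_iff_mem _).mpr hβP
      obtain ⟨Q, hQ, hQP⟩ := (hP.multiset_prod_le).mp this
      have hQm : Q.IsMaximal := (hSprime Q (hTmem Q hQ)).isMaximal (hSne Q (hTmem Q hQ))
      exact h (hQm.eq_of_le hP.ne_top hQP ▸ hTmem Q hQ)
  have hαe : α = β * ⟨γ, hγR⟩ := Subtype.ext hγ
  rcases hα.isUnit_or_isUnit hαe with hu | hu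
  · obtain ⟨Q, hQ⟩ := Multiset.exists_mem_of_ne_zero hT0
    have h1 : T.prod ≤ Q := Ideal.dvd_iff_le.mp (Multiset.dvd_prod hQ)
    have hu' : IsUnit (β : 𝓞 K) := hu.map R.subtype
    rw [hβ, Ideal.span_singleton_eq_top.mpr hu'] at h1
    exact (hSprime Q (hTmem Q hQ)).ne_top (top_le_iff.mp h1)
  · exact (hSprime Q₀ hQ₀).ne_top (Ideal.eq_top_of_isUnit_mem _ hγQ (hu.map R.subtype))
end

section
/- Let R be an order in a number field K whose conductor P is a prime ideal of 𝓞_K that is not principal as an ideal of 𝓞_K. Let D ∈ ℕ be such that every multiset of D elements of Cl(R) has a nonempty submultiset whose sum is zero. Then for every nonzero nonunit α ∈ R and any two factorizations α = π_1⋯π_m = τ_1⋯τ_n into irreducibles of R with m ≤ n, one has 2n ≤ D·m. (That is, the elasticity of R is at most D/2.) -/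
set_option synthInstance.maxHeartbeats 1000000
set_option maxHeartbeats 1000000

open NumberField

namespace OrdElast

theorem exists_le_map {α β : Type*} (f : α → β) (S : Multiset α) (T : Multiset β)
    (h : T ≤ S.map f) : ∃ T' ≤ S, T'.map f = T := by
  have h1 : T ∈ Multiset.powersetCard (Multiset.card T) (S.map f) :=
    Multiset.mem_powersetCard.2 ⟨h, rfl⟩
  rw [Multiset.powersetCard_map] at h1
  obtain ⟨T', hT', h2⟩ := Multiset.mem_map.1 h1
  exact ⟨T', (Multiset.mem_powersetCard.1 hT').1, h2⟩

section
variable {O : Type*} [CommRing O] [IsDedekindDomain O] (R : Subring O) (P : Ideal O)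

/-- cancellation: if `x ∈ R` is prime to `P` and `x z ∈ R` then `z ∈ R`. -/
theorem mem_of_mul_mem [Finite (O ⧸ P)] (hP : P.IsPrime) (hPR : ∀ x ∈ P, x ∈ R)
    {x z : O} (hx : x ∈ R) (hxP : x ∉ P) (hxz : x * z ∈ R) : z ∈ R := by
  obtain ⟨i, j, hij, h⟩ :=
    Finite.exists_ne_map_eq_of_infinite (fun n : ℕ => (Ideal.Quotient.mk P (x ^ n)))
  wlog hlt : i < j generalizing i j
  · exact this j i hij.symm h.symm (by omega)
  obtain ⟨k, rfl⟩ : ∃ k, j = i + (k + 1) := ⟨j - i - 1, by omega⟩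
  have h1 : x ^ i * (1 - x ^ k * x) ∈ P := by
    have := Ideal.Quotient.eq.1 h
    convert this using 1
    ring
  have h2 : 1 - x ^ k * x ∈ P := by
    rcases hP.mem_or_mem h1 with h3 | h3
    · exact absurd (hP.mem_of_pow_mem _ h3) hxP
    · exact h3
  have h3 : z = x ^ k * (x * z) + (1 - x ^ k * x) * z := by ring
  rw [h3]
  exact R.add_mem (R.mul_mem (R.pow_mem hx _) hxz) (hPR _ (P.mul_mem_right _ h2))

theorem mem_of_one_sub (hPR : ∀ x ∈ P, x ∈ R) {a : O} (h : 1 - a ∈ P) : a ∈ R := by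
  have : a = 1 - (1 - a) := by ring
  rw [this]
  exact R.sub_mem R.one_mem (hPR _ h)

theorem map_comap (hPR : ∀ x ∈ P, x ∈ R) (A : Ideal O) (hA : ∃ a ∈ A, 1 - a ∈ P) :
    (A.comap R.subtype).map R.subtype = A := by
  apply le_antisymm Ideal.map_comap_le
  obtain ⟨a, haA, haP⟩ := hA
  intro x hx
  have h3 : x = x * a + x * (1 - a) := by ring
  rw [h3]
  have haR := mem_of_one_sub R P hPR haP
  refine Ideal.add_mem _ (Ideal.mul_mem_left _ _ ?_) ?_
  · exact Ideal.mem_map_of_mem (I := A.comap R.subtype) R.subtype (x := ⟨a, haR⟩) haA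
  · exact Ideal.mem_map_of_mem (I := A.comap R.subtype) R.subtype
      (x := ⟨x * (1 - a), hPR _ (P.mul_mem_left _ haP)⟩) (A.mul_mem_right _ hx)

theorem comap_mul (hPR : ∀ x ∈ P, x ∈ R) (A B : Ideal O) (hA : ∃ a ∈ A, 1 - a ∈ P)
    (hB : ∃ a ∈ B, 1 - a ∈ P) :
    (A * B).comap R.subtype ≤ A.comap R.subtype * B.comap R.subtype := by
  obtain ⟨a, haA, haP⟩ := hA
  obtain ⟨b, hbB, hbP⟩ := hB
  have haR := mem_of_one_sub R P hPR haP
  have hbR := mem_of_one_sub R P hPR hbP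
  have heP : 1 - a * b ∈ P := by
    have : 1 - a * b = (1 - a) + a * (1 - b) := by ring
    rw [this]
    exact P.add_mem haP (P.mul_mem_left _ hbP)
  set I := A.comap R.subtype * B.comap R.subtype with hI
  have key : ∀ q ∈ P, ∀ y ∈ A * B, ∃ h : y * (q * q) ∈ R, (⟨y * (q * q), h⟩ : R) ∈ I := by
    intro q hq y hy
    refine Submodule.mul_induction_on hy ?_ ?_
    · intro r hr s hs
      have h1 : r * q ∈ R := hPR _ (P.mul_mem_left _ hq)
      have h2 : s * q ∈ R := hPR _ (P.mul_mem_left _ hq)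
      have h3 : r * s * (q * q) = (r * q) * (s * q) := by ring
      refine ⟨h3 ▸ R.mul_mem h1 h2, ?_⟩
      have h4 : (⟨r * q, h1⟩ * ⟨s * q, h2⟩ : R) ∈ I :=
        Ideal.mul_mem_mul (A.mul_mem_right _ hr : r * q ∈ A) (B.mul_mem_right _ hs : s * q ∈ B)
      convert h4 using 1
      exact Subtype.ext h3
    · rintro y z ⟨h1, h2⟩ ⟨h3, h4⟩
      have h5 : (y + z) * (q * q) = y * (q * q) + z * (q * q) := by ring
      refine ⟨h5 ▸ R.add_mem h1 h3, ?_⟩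
      convert I.add_mem h2 h4 using 1
      exact Subtype.ext h5
  rintro ⟨x, hxR⟩ hx
  obtain ⟨h1, h2⟩ := key _ heP x hx
  have he : (⟨a, haR⟩ * ⟨b, hbR⟩ : R) ∈ I := Ideal.mul_mem_mul haA hbB
  have h3 := I.add_mem h2 (I.mul_mem_right ((2 - ⟨a, haR⟩ * ⟨b, hbR⟩) * ⟨x, hxR⟩) he)
  convert h3 using 1
  apply Subtype.ext
  change x = x * ((1 - a * b) * (1 - a * b)) + a * b * ((2 - a * b) * x)
  ring

theorem exists_inv [Finite (O ⧸ P)] (hP : P.IsPrime) (hPR : ∀ x ∈ P, x ∈ R) (A : Ideal O)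
    (hA : ∃ a ∈ A, 1 - a ∈ P) :
    ∃ (J : Ideal R) (c : R), c ≠ 0 ∧ A.comap R.subtype * J = Ideal.span {c} := by
  obtain ⟨c, hcA, hcP⟩ := id hA
  have hcR := mem_of_one_sub R P hPR hcP
  have hcnP : c ∉ P := fun h => hP.ne_top ((Ideal.eq_top_iff_one _).2 (by
    have := P.add_mem hcP h
    simpa using this))
  have hc0 : c ≠ 0 := fun h => hcnP (h ▸ P.zero_mem)
  obtain ⟨B, hB⟩ := Ideal.dvd_span_singleton.2 hcA
  have hcB : c ∈ B := by
    have : c ∈ A * B := hB ▸ Ideal.mem_span_singleton_self c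
    exact Ideal.mul_le_right this
  refine ⟨B.comap R.subtype, ⟨c, hcR⟩, fun h => hc0 (congrArg Subtype.val h), ?_⟩
  apply le_antisymm
  · rw [Ideal.mul_le]
    rintro ⟨r, hr⟩ hrA ⟨s, hs⟩ hsB
    have h1 : r * s ∈ Ideal.span {c} := hB ▸ Ideal.mul_mem_mul hrA hsB
    obtain ⟨z, hz⟩ := Ideal.mem_span_singleton.1 h1
    have hzR : z ∈ R := mem_of_mul_mem R P hP hPR hcR hcnP (hz ▸ R.mul_mem hr hs)
    exact Ideal.mem_span_singleton.2 ⟨⟨z, hzR⟩, Subtype.ext hz⟩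
  · refine le_trans ?_ (comap_mul R P hPR A B hA ⟨c, hcB, hcP⟩)
    rw [← hB, Ideal.span_singleton_le_iff_mem]
    exact Ideal.mem_span_singleton_self c

theorem exists_cls [Finite (O ⧸ P)] (hP : P.IsPrime) (hPR : ∀ x ∈ P, x ∈ R) :
    ∃ cls : Ideal O → ClassGroup R, ∀ T : Multiset (Ideal O),
      (∀ A ∈ T, ∃ a ∈ A, 1 - a ∈ P) → (T.map cls).prod = 1 →
      ∃ β : R, T.prod = Ideal.span {(β : O)} := by
  have h1 : ∀ A : Ideal O, (∃ a ∈ A, 1 - a ∈ P) →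
      ∃ u : (FractionalIdeal (nonZeroDivisors R) (FractionRing R))ˣ,
        (u : FractionalIdeal (nonZeroDivisors R) (FractionRing R)) =
          ((A.comap R.subtype : Ideal R) : FractionalIdeal (nonZeroDivisors R) (FractionRing R)) := by
    intro A hA
    obtain ⟨J, c, hc, h⟩ := exists_inv R P hP hPR A hA
    have h2 : IsUnit ((A.comap R.subtype : Ideal R) :
        FractionalIdeal (nonZeroDivisors R) (FractionRing R)) := by
      apply isUnit_of_mul_isUnit_left
        (y := (J : FractionalIdeal (nonZeroDivisors R) (FractionRing R)))
      rw [← FractionalIdeal.coeIdeal_mul, h, FractionalIdeal.coeIdeal_span_singleton]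
      have hc' : algebraMap R (FractionRing R) c ≠ 0 := by
        simpa using hc
      refine IsUnit.of_mul_eq_one
        (FractionalIdeal.spanSingleton (nonZeroDivisors R) (algebraMap R (FractionRing R) c)⁻¹) ?_
      rw [FractionalIdeal.spanSingleton_mul_spanSingleton, mul_inv_cancel₀ hc',
        FractionalIdeal.spanSingleton_one]
    exact ⟨h2.unit, rfl⟩
  choose! u hu using h1
  refine ⟨fun A => ClassGroup.mk (FractionRing R) (u A), ?_⟩
  intro T hT hprod
  have h2 : (((T.map u).prod : (FractionalIdeal (nonZeroDivisors R) (FractionRing R))ˣ) :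
      FractionalIdeal (nonZeroDivisors R) (FractionRing R)) =
      (((T.map (fun A => A.comap R.subtype)).prod : Ideal R) :
        FractionalIdeal (nonZeroDivisors R) (FractionRing R)) ∧
      Ideal.map R.subtype ((T.map (fun A => A.comap R.subtype)).prod : Ideal R) = T.prod := by
    clear hprod
    induction T using Multiset.induction_on with
    | empty => simp [Ideal.one_eq_top, Ideal.map_top]
    | cons A T ih =>
      obtain ⟨ih1, ih2⟩ := ih (fun B hB => hT B (Multiset.mem_cons_of_mem hB))
      have hA := hT A (Multiset.mem_cons_self _ _)
      simp only [Multiset.map_cons, Multiset.prod_cons]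
      constructor
      · rw [Units.val_mul, ih1, hu A hA, FractionalIdeal.coeIdeal_mul]
      · rw [Ideal.map_mul, ih2, map_comap R P hPR A hA]
  have h3 : ClassGroup.mk (FractionRing R) (T.map u).prod = 1 := by
    rw [map_multiset_prod, Multiset.map_map]
    exact hprod
  obtain ⟨x, -, hx⟩ := (ClassGroup.mk_eq_one_of_coe_ideal h2.1).1 h3
  refine ⟨x, ?_⟩
  rw [← h2.2, hx, Ideal.map_span, Set.image_singleton]
  rfl

theorem exists_A0 (hP : P.IsPrime) (hP0 : P ≠ ⊥) :
    ∃ (A : Ideal O) (u v : O), u ≠ 0 ∧ v ≠ 0 ∧ (∃ a ∈ A, 1 - a ∈ P) ∧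
      P * Ideal.span {v} = A * Ideal.span {u} := by
  obtain ⟨x, hxP, hx0⟩ := Submodule.exists_mem_ne_zero_of_ne_bot hP0
  obtain ⟨C, hC⟩ := Ideal.dvd_span_singleton.2 hxP
  have hPC : P * C ≠ 0 := by
    rw [← hC]
    simpa using hx0
  have hC0 : C ≠ 0 := right_ne_zero_of_mul hPC
  obtain ⟨a, ha⟩ := IsDedekindDomain.exists_sup_span_eq (I := P * C) (J := C)
    Ideal.mul_le_right hPC
  have haC : a ∈ C := by
    rw [← ha]
    exact Ideal.mem_sup_right (Ideal.mem_span_singleton_self a)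
  obtain ⟨A, hA⟩ := Ideal.dvd_span_singleton.2 haC
  have h1 : C * (P ⊔ A) = C * 1 := by
    rw [Ideal.mul_sup, ← hA, mul_comm C P, ha, mul_one]
  have h2 : P ⊔ A = ⊤ := by
    rw [mul_left_cancel₀ hC0 h1, Ideal.one_eq_top]
  have ha0 : a ≠ 0 := by
    rintro rfl
    have h3 : C * A = 0 := by rw [← hA]; simp
    rcases mul_eq_zero.1 h3 with h | h
    · exact hC0 h
    · rw [h] at h2
      exact hP.ne_top (by simpa using h2)
  refine ⟨A, x, a, hx0, ha0, ?_, ?_⟩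
  · obtain ⟨q, hq, r, hr, h⟩ := Ideal.isCoprime_iff_exists.1 (Ideal.isCoprime_iff_sup_eq.2 h2)
    exact ⟨r, hr, by rw [← h]; simpa using hq⟩
  · rw [hA, hC]; ring

/-- The main class-group input. -/
theorem exists_g [Finite (O ⧸ P)] (hP : P.IsPrime) (hP0 : P ≠ ⊥) (hPR : ∀ x ∈ P, x ∈ R) :
    ∃ g : Ideal O → ClassGroup R, ∀ T : Multiset (Ideal O),
      (∀ A ∈ T, Prime A) → (T.map g).prod = 1 →
      ∃ w ∈ R, T.prod = Ideal.span {w} := by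
  classical
  obtain ⟨cls, hcls⟩ := exists_cls R P hP hPR
  obtain ⟨A0, u, v, hu, hv, hA0, hPA⟩ := exists_A0 P hP hP0
  set f : Ideal O → Ideal O := fun Q => if Q = P then A0 else Q with hf
  have hPmax : P.IsMaximal := hP.isMaximal hP0
  refine ⟨fun Q => cls (f Q), fun T hT h1 => ?_⟩
  have h2 : ∀ A ∈ T.map f, ∃ a ∈ A, 1 - a ∈ P := by
    intro A hA
    obtain ⟨Q, hQ, rfl⟩ := Multiset.mem_map.1 hA
    by_cases hQP : Q = P
    · simpa [hf, hQP] using hA0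
    · simp only [hf, if_neg hQP]
      have hQm : Q.IsMaximal := (Ideal.isPrime_of_prime (hT Q hQ)).isMaximal (hT Q hQ).ne_zero
      have h3 : Q ⊔ P = ⊤ := hQm.coprime_of_ne hPmax hQP
      obtain ⟨q, hq, r, hr, h⟩ := Ideal.isCoprime_iff_exists.1 (Ideal.isCoprime_iff_sup_eq.2 h3)
      exact ⟨q, hq, by rw [← h]; simpa using hr⟩
  obtain ⟨β, hβ⟩ := hcls (T.map f) h2 (by rw [Multiset.map_map]; exact h1)
  by_cases hPT : P ∈ T
  · have h4 : ∀ T : Multiset (Ideal O), ∃ u v : O, v ≠ 0 ∧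
        T.prod * Ideal.span {v} = (T.map f).prod * Ideal.span {u} := by
      intro T
      induction T using Multiset.induction_on with
      | empty => exact ⟨1, 1, by
          rintro h
          exact one_ne_zero h, by simp⟩
      | cons Q T ih =>
        obtain ⟨u', v', hv', ih⟩ := ih
        simp only [Multiset.map_cons, Multiset.prod_cons]
        by_cases hQP : Q = P
        · refine ⟨u * u', v * v', mul_ne_zero hv hv', ?_⟩
          simp only [hf, if_pos hQP] at ih ⊢
          rw [← Ideal.span_singleton_mul_span_singleton, ← Ideal.span_singleton_mul_span_singleton,
            hQP, mul_mul_mul_comm, hPA, ih]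
          ring
        · refine ⟨u', v', hv', ?_⟩
          have : f Q = Q := by simp [hf, hQP]
          rw [this, mul_assoc, ih, mul_assoc]
    obtain ⟨u', v', hv', h5⟩ := h4 T
    rw [hβ, Ideal.span_singleton_mul_span_singleton] at h5
    have h6 : (β : O) * u' ∈ Ideal.span {v'} := by
      have : (β : O) * u' ∈ T.prod * Ideal.span {v'} := h5 ▸ Ideal.mem_span_singleton_self _
      exact Ideal.mul_le_right this
    obtain ⟨w, hw⟩ := Ideal.mem_span_singleton.1 h6
    have h7 : T.prod = Ideal.span {w} := by
      rw [hw, mul_comm v', ← Ideal.span_singleton_mul_span_singleton] at h5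
      exact mul_right_cancel₀ (by simpa using hv') h5
    refine ⟨w, hPR _ ?_, h7⟩
    have h8 : T.prod ≤ P := Ideal.le_of_dvd (Multiset.dvd_prod hPT)
    exact h8 (h7 ▸ Ideal.mem_span_singleton_self w)
  · refine ⟨β, β.2, ?_⟩
    rw [← hβ]
    congr 1
    symm
    rw [Multiset.map_congr rfl (g := id), Multiset.map_id]
    intro Q hQ
    have : Q ≠ P := fun h => hPT (h ▸ hQ)
    simp [hf, this]

open UniqueFactorizationMonoid in
/-- number of prime ideal factors of `x` in `O`. -/
noncomputable def len (x : O) : ℕ := Multiset.card (normalizedFactors (Ideal.span {x}))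

open UniqueFactorizationMonoid in
theorem len_mul {x y : O} (hx : x ≠ 0) (hy : y ≠ 0) : len (x * y) = len x + len y := by
  unfold len
  rw [← Ideal.span_singleton_mul_span_singleton, normalizedFactors_mul (by simpa using hx)
    (by simpa using hy), Multiset.card_add]

open UniqueFactorizationMonoid in
theorem len_le [Finite (O ⧸ P)] (hP : P.IsPrime) (hP0 : P ≠ ⊥) (hPR : ∀ x ∈ P, x ∈ R) (D : ℕ)
    (hD : ∀ S : Multiset (ClassGroup R), Multiset.card S = D →
      ∃ T ≤ S, T ≠ 0 ∧ T.prod = 1) (x : R) (hx : Irreducible x) : len (x : O) ≤ D := by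
  classical
  obtain ⟨g, hg⟩ := exists_g R P hP hP0 hPR
  by_contra hlt
  push Not at hlt
  have hx0 : (x : O) ≠ 0 := fun h => hx.ne_zero (Subtype.ext h)
  have hsp : Ideal.span {(x : O)} ≠ ⊥ := by simpa using hx0
  set F := normalizedFactors (Ideal.span {(x : O)}) with hF
  have hFp : ∀ Q ∈ F, Prime Q := fun Q hQ => prime_of_normalized_factor Q hQ
  have hFprod : F.prod = Ideal.span {(x : O)} := Ideal.prod_normalizedFactors_eq_self hsp
  have hcard : D + 1 ≤ Multiset.card F := hlt
  have hcE : D ≤ Multiset.card (F.erase P) := by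
    have : Multiset.card F ≤ Multiset.card (F.erase P) + 1 := by
      by_cases h : P ∈ F
      · rw [Multiset.card_erase_add_one h]
      · rw [Multiset.erase_of_notMem h]; omega
    omega
  obtain ⟨S, hS'⟩ := Multiset.card_pos_iff_exists_mem.1
    (show 0 < Multiset.card (Multiset.powersetCard D (F.erase P)) by
      rw [Multiset.card_powersetCard]
      exact Nat.choose_pos hcE)
  obtain ⟨hSle, hS⟩ := Multiset.mem_powersetCard.1 hS'
  obtain ⟨T0, hT0, hT0ne, hT0p⟩ := hD (S.map g) (by simpa using hS)
  obtain ⟨T, hTS, rfl⟩ := exists_le_map g S T0 hT0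
  have hTE : T ≤ F.erase P := hTS.trans hSle
  have hTF : T ≤ F := hTE.trans (Multiset.erase_le _ _)
  have hTne : T ≠ 0 := by rintro rfl; exact hT0ne rfl
  obtain ⟨w, hwR, hw⟩ := hg T (fun A hA => hFp A (Multiset.mem_of_le hTF hA)) hT0p
  have hsplit : T.prod * (F - T).prod = Ideal.span {(x : O)} := by
    rw [← Multiset.prod_add, add_tsub_cancel_of_le hTF, hFprod]
  have hUne : F - T ≠ 0 := by
    intro h
    have h1 := congrArg Multiset.card h
    rw [Multiset.card_sub hTF, Multiset.card_zero] at h1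
    have h2 := Multiset.card_le_card hTS
    omega
  have hnu : ∀ U ≤ F, U ≠ 0 → U.prod ≠ ⊤ := by
    intro U hU hU0 h
    obtain ⟨Q, hQ⟩ := Multiset.exists_mem_of_ne_zero hU0
    have h1 : U.prod ≤ Q := Ideal.le_of_dvd (Multiset.dvd_prod hQ)
    rw [h, top_le_iff] at h1
    exact (Ideal.isPrime_of_prime (hFp Q (Multiset.mem_of_le hU hQ))).ne_top h1
  have hxw : (x : O) ∈ Ideal.span {w} := by
    rw [← hw]
    have : (x : O) ∈ T.prod * (F - T).prod := hsplit ▸ Ideal.mem_span_singleton_self _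
    exact Ideal.mul_le_left this
  obtain ⟨z, hz⟩ := Ideal.mem_span_singleton.1 hxw
  have hw0 : w ≠ 0 := by
    rintro rfl
    exact hx0 (by rw [hz, zero_mul])
  have hzU : (F - T).prod = Ideal.span {z} := by
    rw [hw, hz, ← Ideal.span_singleton_mul_span_singleton] at hsplit
    exact mul_left_cancel₀ (by simpa using hw0) hsplit
  have hzR : z ∈ R := by
    by_cases hPF : P ∈ F
    · have h1 : P ∈ F - T := by
        rw [← Multiset.count_pos, Multiset.count_sub]
        have h2 := Multiset.count_le_of_le P hTE
        rw [Multiset.count_erase_self] at h2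
        have h3 := Multiset.count_pos.2 hPF
        omega
      have h2 : (F - T).prod ≤ P := Ideal.le_of_dvd (Multiset.dvd_prod h1)
      exact hPR _ (h2 (hzU ▸ Ideal.mem_span_singleton_self z))
    · refine mem_of_mul_mem R P hP hPR hwR (fun h => hPF ?_) (hz ▸ x.2)
      have h1 : F.prod ≤ P := by
        rw [hFprod, Ideal.span_singleton_le_iff_mem, hz]
        exact P.mul_mem_right _ h
      obtain ⟨Q, hQ, hQd⟩ :=
        (Ideal.prime_of_isPrime hP0 hP).exists_mem_multiset_dvd (Ideal.dvd_iff_le.2 h1)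
      have hQP : Q ≤ P := Ideal.le_of_dvd hQd
      have hQm : Q.IsMaximal := (Ideal.isPrime_of_prime (hFp Q hQ)).isMaximal (hFp Q hQ).ne_zero
      rwa [← hQm.eq_of_le hP.ne_top hQP]
  have hfac : x = ⟨w, hwR⟩ * ⟨z, hzR⟩ := Subtype.ext hz
  rcases hx.isUnit_or_isUnit hfac with h | h
  · apply hnu T hTF hTne
    rw [hw, Ideal.span_singleton_eq_top]
    exact h.map R.subtype
  · apply hnu (F - T) (Multiset.sub_le_self _ _) hUne
    rw [hzU, Ideal.span_singleton_eq_top]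
    exact h.map R.subtype

open UniqueFactorizationMonoid in
theorem prime_or_two_le [Finite (O ⧸ P)] (hP : P.IsPrime) (hP0 : P ≠ ⊥)
    (hPR : ∀ x ∈ P, x ∈ R) (hnp : ¬ P.IsPrincipal) (x : R) (hx : Irreducible x) :
    Prime x ∨ 2 ≤ len (x : O) := by
  have hx0 : (x : O) ≠ 0 := fun h => hx.ne_zero (Subtype.ext h)
  have hsp : Ideal.span {(x : O)} ≠ ⊥ := by simpa using hx0
  have hFprod := Ideal.prod_normalizedFactors_eq_self hsp
  by_contra hcon
  push Not at hcon
  obtain ⟨hpr, hlen⟩ := hcon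
  unfold len at hlen
  have h01 : Multiset.card (normalizedFactors (Ideal.span {(x : O)})) = 0 ∨
    Multiset.card (normalizedFactors (Ideal.span {(x : O)})) = 1 := by omega
  rcases h01 with h | h
  · rw [Multiset.card_eq_zero] at h
    rw [h, Multiset.prod_zero, eq_comm, Ideal.one_eq_top, Ideal.span_singleton_eq_top] at hFprod
    obtain ⟨y, hy⟩ := hFprod.exists_right_inv
    have hxP : (x : O) ∉ P := fun h => hP.ne_top (Ideal.eq_top_of_isUnit_mem _ h hFprod)
    have hyR : y ∈ R := mem_of_mul_mem R P hP hPR x.2 hxP (hy ▸ R.one_mem)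
    exact hx.not_isUnit (IsUnit.of_mul_eq_one ⟨y, hyR⟩ (Subtype.ext hy))
  · obtain ⟨Q, hQ⟩ := Multiset.card_eq_one.1 h
    have hQp : Prime Q := prime_of_normalized_factor Q (by rw [hQ]; simp)
    rw [hQ, Multiset.prod_singleton] at hFprod
    have hQi := Ideal.isPrime_of_prime hQp
    have hQm : Q.IsMaximal := hQi.isMaximal hQp.ne_zero
    have hxP : (x : O) ∉ P := by
      intro hxP
      have h1 : Q ≤ P := by rwa [hFprod, Ideal.span_singleton_le_iff_mem]
      have h2 := hQm.eq_of_le hP.ne_top h1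
      exact hnp ⟨⟨(x : O), by rw [← h2, hFprod]⟩⟩
    have hdvd : ∀ a : R, (a : O) ∈ Q → x ∣ a := by
      intro a ha
      rw [hFprod] at ha
      obtain ⟨z, hz⟩ := Ideal.mem_span_singleton.1 ha
      exact ⟨⟨z, mem_of_mul_mem R P hP hPR x.2 hxP (hz ▸ a.2)⟩, Subtype.ext hz⟩
    refine hpr ⟨hx.ne_zero, hx.not_isUnit, fun a b ⟨c, hc⟩ => ?_⟩
    have h1 : (a : O) * b ∈ Q := by
      rw [hFprod]
      exact Ideal.mem_span_singleton.2 ⟨c, congrArg Subtype.val hc⟩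
    exact (hQi.mem_or_mem h1).imp (hdvd a) (hdvd b)

theorem two_le_D [Finite (O ⧸ P)] (hP : P.IsPrime) (hP0 : P ≠ ⊥)
    (hPR : ∀ x ∈ P, x ∈ R) (hnp : ¬ P.IsPrincipal) (D : ℕ)
    (hD : ∀ S : Multiset (ClassGroup R), Multiset.card S = D →
      ∃ T ≤ S, T ≠ 0 ∧ T.prod = 1) : 2 ≤ D := by
  by_contra hlt
  have h01 : D = 0 ∨ D = 1 := by omega
  rcases h01 with rfl | rfl
  · obtain ⟨T, hT, hT0, -⟩ := hD 0 rfl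
    exact hT0 (Multiset.le_zero.1 hT)
  · obtain ⟨g, hg⟩ := exists_g R P hP hP0 hPR
    obtain ⟨T0, hT0, hT0ne, hT0p⟩ := hD (({P} : Multiset (Ideal O)).map g) (by simp)
    obtain ⟨T, hTS, rfl⟩ := exists_le_map g _ T0 hT0
    rcases Multiset.le_singleton.1 hTS with rfl | rfl
    · exact hT0ne rfl
    · obtain ⟨w, -, hw⟩ := hg {P} (by simpa using Ideal.prime_of_isPrime hP0 hP) hT0p
      rw [Multiset.prod_singleton] at hw
      exact hnp ⟨⟨w, hw⟩⟩

theorem len_prod (s : Multiset R) (hs : ∀ x ∈ s, Irreducible x) :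
    len ((s.prod : R) : O) = (s.map (fun x : R => len (x : O))).sum := by
  induction s using Multiset.induction_on with
  | empty => simp [len, ← Ideal.one_eq_top]
  | cons a s ih =>
    have h1 : ∀ x ∈ s, Irreducible x := fun x hx => hs x (Multiset.mem_cons_of_mem hx)
    rw [Multiset.prod_cons, Multiset.map_cons, Multiset.sum_cons, ← ih h1, Subring.coe_mul]
    apply len_mul
    · exact fun h => (hs a (Multiset.mem_cons_self _ _)).ne_zero (Subtype.ext h)
    · intro h
      have : s.prod = 0 := Subtype.ext h
      rw [Multiset.prod_eq_zero_iff] at this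
      exact (h1 0 this).ne_zero rfl

theorem main [Finite (O ⧸ P)] (hP : P.IsPrime) (hP0 : P ≠ ⊥)
    (hPR : ∀ x ∈ P, x ∈ R) (hnp : ¬ P.IsPrincipal) (D : ℕ)
    (hD : ∀ S : Multiset (ClassGroup R), Multiset.card S = D →
      ∃ T ≤ S, T ≠ 0 ∧ T.prod = 1) (N : ℕ) : ∀ (s t : Multiset R), Multiset.card t = N →
      (∀ x ∈ s, Irreducible x) → (∀ x ∈ t, Irreducible x) →
      Associated s.prod t.prod → 2 * Multiset.card t ≤ D * Multiset.card s := by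
  classical
  have hD2 := two_le_D R P hP hP0 hPR hnp D hD
  induction N with
  | zero => intro s t h; simp [h]
  | succ N ih =>
    intro s t hN hs ht hst
    by_cases hpr : ∃ y ∈ t, Prime y
    · obtain ⟨y, hyt, hy⟩ := hpr
      obtain ⟨t', rfl⟩ := Multiset.exists_cons_of_mem hyt
      have hys : y ∣ s.prod := by
        refine dvd_trans ?_ hst.symm.dvd
        rw [Multiset.prod_cons]
        exact dvd_mul_right _ _
      obtain ⟨x, hxs, hyx⟩ := hy.exists_mem_multiset_dvd hys
      have hassoc : Associated x y := ((hy.irreducible.dvd_irreducible_iff_associated (hs x hxs)).1 hyx).symm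
      obtain ⟨s', rfl⟩ := Multiset.exists_cons_of_mem hxs
      rw [Multiset.prod_cons, Multiset.prod_cons] at hst
      have h1 := hst.of_mul_left hassoc (hs x hxs).ne_zero
      have h2 := ih s' t' (by simpa using hN)
        (fun z hz => hs z (Multiset.mem_cons_of_mem hz))
        (fun z hz => ht z (Multiset.mem_cons_of_mem hz)) h1
      rw [Multiset.card_cons, Multiset.card_cons, mul_add, mul_add]
      omega
    · push Not at hpr
      have h1 : Multiset.card t * 2 ≤ (t.map (fun x : R => len (x : O))).sum := by
        have := Multiset.card_nsmul_le_sum (s := t.map (fun x : R => len (x : O))) (a := 2) (by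
          intro k hk
          obtain ⟨y, hy, rfl⟩ := Multiset.mem_map.1 hk
          exact (prime_or_two_le R P hP hP0 hPR hnp y (ht y hy)).resolve_left (hpr y hy))
        simpa using this
      have h2 : (s.map (fun x : R => len (x : O))).sum ≤ Multiset.card s * D := by
        have := Multiset.sum_le_card_nsmul (s.map (fun x : R => len (x : O))) D (by
          intro k hk
          obtain ⟨y, hy, rfl⟩ := Multiset.mem_map.1 hk
          exact len_le R P hP hP0 hPR D hD y (hs y hy))
        simpa using this
      rw [← len_prod R t ht] at h1
      rw [← len_prod R s hs] at h2
      have h3 : len ((s.prod : R) : O) = len ((t.prod : R) : O) := by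
        have h4 : Ideal.span {((s.prod : R) : O)} = Ideal.span {((t.prod : R) : O)} :=
          Ideal.span_singleton_eq_span_singleton.2 (hst.map R.subtype)
        unfold len
        rw [h4]
      rw [mul_comm D]
      omega

end

end OrdElast

/-- If the conductor of the order `R` is a non-principal prime ideal of `𝓞 K` and every
multiset of `D` elements of `Cl(R)` has a nonempty zero-sum (product-one) submultiset,
then for any two irreducible factorizations `α = π_1⋯π_m = τ_1⋯τ_n` of a nonzero nonunit
`α ∈ R` with `m ≤ n`, one has `2n ≤ D·m` (the elasticity of `R` is at most `D/2`). -/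
theorem stmt_10 {K : Type*} [Field K] [NumberField K] (R : Subring (𝓞 K))
    (hR : Finite ((𝓞 K) ⧸ R.toAddSubgroup))
    (hP : (conductorIdeal R).IsPrime)
    (hnp : ¬(conductorIdeal R).IsPrincipal)
    (D : ℕ)
    (hD : ∀ S : Multiset (ClassGroup R), Multiset.card S = D →
      ∃ T ≤ S, T ≠ 0 ∧ T.prod = 1)
    (α : R) (hα0 : α ≠ 0) (hαu : ¬IsUnit α)
    (m n : ℕ) (p : Fin m → R) (t : Fin n → R)
    (hp : ∀ i, Irreducible (p i)) (ht : ∀ j, Irreducible (t j))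
    (hpeq : α = ∏ i, p i) (hteq : α = ∏ j, t j) (hmn : m ≤ n) :
    2 * n ≤ D * m := by
  have hP0 : conductorIdeal R ≠ ⊥ := by
    intro h
    exact hnp (h ▸ inferInstance)
  have hPR : ∀ x ∈ conductorIdeal R, x ∈ R := fun x hx => by
    have := hx 1
    rwa [mul_one] at this
  have hPm : (conductorIdeal R).IsMaximal := hP.isMaximal hP0
  have hfin : Finite (𝓞 K ⧸ conductorIdeal R) := inferInstance
  have h := OrdElast.main R (conductorIdeal R) hP hP0 hPR hnp D hD n
    (Finset.univ.val.map p) (Finset.univ.val.map t) (by simp)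
    (by
      intro x hx
      obtain ⟨i, -, rfl⟩ := Multiset.mem_map.1 hx
      exact hp i)
    (by
      intro x hx
      obtain ⟨i, -, rfl⟩ := Multiset.mem_map.1 hx
      exact ht i)
    (by
      have h1 : (Finset.univ.val.map p).prod = (Finset.univ.val.map t).prod := hpeq.symm.trans hteq
      rw [h1])
  simpa using h
end

section
/- Let R be an order in a number field K whose conductor is P = π𝓞_K, a principal prime ideal of 𝓞_K with π ∈ R. Let D ∈ ℕ be such that every multiset of D elements of Cl(R) has a nonempty submultiset whose sum is zero. Then for every nonzero nonunit α ∈ R and any two factorizations α = π_1⋯π_m = τ_1⋯τ_n into irreducibles of R with m ≤ n, one has 2n ≤ (D+1)·m. (That is, the elasticity of R is at most (D+1)/2.) -/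
set_option synthInstance.maxHeartbeats 1000000
set_option maxHeartbeats 1000000

open NumberField

section Aux
variable {O : Type*} [CommRing O] [IsDedekindDomain O] (R : Subring O) (P : Ideal O)

theorem aux_pow [P.IsMaximal] [Finite (O ⧸ P)] (x : O) (hx : x ∉ P) :
    ∃ N : ℕ, N ≠ 0 ∧ x ^ N - 1 ∈ P := by
  let _ := Ideal.Quotient.field P
  have hx' : (Ideal.Quotient.mk P x) ≠ 0 := by
    rwa [Ne, Ideal.Quotient.eq_zero_iff_mem]
  have h := isOfFinOrder_of_finite (Units.mk0 _ hx')
  obtain ⟨N, hN, h⟩ := h.exists_pow_eq_one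
  refine ⟨N, hN.ne', ?_⟩
  rw [← Ideal.Quotient.eq_zero_iff_mem, map_sub, map_pow, map_one, sub_eq_zero]
  simpa [Units.ext_iff] using h

theorem aux_div [P.IsMaximal] [Finite (O ⧸ P)] (hP : ∀ x ∈ P, x ∈ R) (g d : O)
    (hg : g ∈ R) (hgP : g ∉ P) (h : g * d ∈ R) : d ∈ R := by
  obtain ⟨N, hN, hN'⟩ := aux_pow P g hgP
  obtain ⟨k, rfl⟩ := Nat.exists_eq_succ_of_ne_zero hN
  have h1 : g ^ k * (g * d) ∈ R := R.mul_mem (R.pow_mem hg k) h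
  have h2 : (g ^ (k + 1) - 1) * d ∈ R := hP _ (P.mul_mem_right _ hN')
  have := R.sub_mem h1 h2
  convert this using 1
  ring

theorem aux_unit [P.IsMaximal] [Finite (O ⧸ P)] (hP : ∀ x ∈ P, x ∈ R) (g : R)
    (h : IsUnit (g : O)) : IsUnit g := by
  obtain ⟨d, hd⟩ := h.exists_right_inv
  have hgP : (g : O) ∉ P := fun h' => (Ideal.IsMaximal.ne_top ‹_›) (Ideal.eq_top_of_isUnit_mem _ h' h)
  have : d ∈ R := aux_div R P hP g d g.2 hgP (by rw [hd]; exact R.one_mem)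
  exact IsUnit.of_mul_eq_one ⟨d, this⟩ (Subtype.ext hd)

theorem aux_map_comap (hP : ∀ x ∈ P, x ∈ R) (q : Ideal O) (hq : IsCoprime q P) :
    (q.comap R.subtype).map R.subtype = q := by
  apply le_antisymm Ideal.map_comap_le
  intro y hy
  obtain ⟨a, ha, c, hc, hac⟩ := Ideal.isCoprime_iff_exists.mp hq
  have haR : a ∈ R := by
    have : a = 1 - c := by rw [← hac]; ring
    rw [this]; exact R.sub_mem R.one_mem (hP c hc)
  have : y = y * a + y * c := by rw [← mul_add, hac, mul_one]
  rw [this]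
  apply Ideal.add_mem
  · exact Ideal.mul_mem_left _ _ (Ideal.mem_map_of_mem R.subtype (x := ⟨a, haR⟩) ha)
  · exact Ideal.mem_map_of_mem R.subtype (x := ⟨y * c, hP _ (P.mul_mem_left _ hc)⟩)
      (I := q.comap R.subtype) (q.mul_mem_right _ hy)

theorem aux_comap_map (hP : ∀ x ∈ P, x ∈ R) (I : Ideal R) (hI : IsCoprime I (P.comap R.subtype)) :
    (I.map R.subtype).comap R.subtype = I := by
  apply le_antisymm _ Ideal.le_comap_map
  intro y hy
  obtain ⟨a, ha, c, hc, hac⟩ := Ideal.isCoprime_iff_exists.mp hI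
  have : y = y * a + y * c := by rw [← mul_add, hac, mul_one]
  rw [this]
  apply Ideal.add_mem _ (I.mul_mem_left _ ha)
  have key : ∀ z ∈ I.map R.subtype, ∀ c ∈ P, ∃ w ∈ I, (w : O) = z * c := by
    intro z hz
    refine Submodule.span_induction ?_ ?_ ?_ ?_ hz
    · rintro _ ⟨x, hx, rfl⟩ c hc
      exact ⟨x * ⟨c, hP c hc⟩, I.mul_mem_right _ hx, rfl⟩
    · intro c hc
      exact ⟨0, I.zero_mem, by simp⟩
    · intro x y _ _ hx hy c hc
      obtain ⟨w, hw, hw'⟩ := hx c hc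
      obtain ⟨v, hv, hv'⟩ := hy c hc
      exact ⟨w + v, I.add_mem hw hv, by simp [hw', hv', add_mul]⟩
    · intro a x _ hx c hc
      obtain ⟨w, hw, hw'⟩ := hx (a * c) (P.mul_mem_left _ hc)
      exact ⟨w, hw, by rw [hw', smul_eq_mul]; ring⟩
  obtain ⟨w, hw, hw'⟩ := key _ hy c hc
  have : y * c = w := Subtype.ext (by rw [hw']; rfl)
  rw [this]; exact hw

open nonZeroDivisors in
theorem aux_inv [Finite (ClassGroup O)] [P.IsMaximal] [Finite (O ⧸ P)] (hP : ∀ x ∈ P, x ∈ R)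
    (q : Ideal O) (hq0 : q ≠ ⊥) (hq : IsCoprime q P) :
    IsUnit ((q.comap R.subtype : Ideal R) : FractionalIdeal R⁰ (FractionRing R)) := by
  have hPt : P ≠ ⊤ := Ideal.IsMaximal.ne_top ‹_›
  -- a power of q is principal
  obtain ⟨h, hh, x, hx⟩ : ∃ h : ℕ, h ≠ 0 ∧ ∃ x : O, q ^ h = Ideal.span {x} := by
    obtain ⟨h, hh, e⟩ := (isOfFinOrder_of_finite
      (ClassGroup.mk0 ⟨q, mem_nonZeroDivisors_of_ne_zero hq0⟩)).exists_pow_eq_one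
    refine ⟨h, hh.ne', ?_⟩
    rw [← map_pow, ClassGroup.mk0_eq_one_iff] at e
    obtain ⟨x, hx⟩ := e.principal
    exact ⟨x, by simpa using hx⟩
  have hqh : IsCoprime (q ^ h) P := hq.pow_left
  have hxP : x ∉ P := by
    intro hxP
    rw [hx] at hqh
    rw [Ideal.isCoprime_iff_sup_eq] at hqh
    apply hPt
    rw [← hqh, eq_comm, sup_eq_right, Ideal.span_singleton_le_iff_mem]
    exact hxP
  obtain ⟨N, hN, hxN⟩ := aux_pow P x hxP
  have hxR : x ^ N ∈ R := by
    have := R.add_mem (hP _ hxN) R.one_mem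
    simpa using this
  have hx0 : x ≠ 0 := by rintro rfl; exact hxP P.zero_mem
  set I := q.comap R.subtype with hI
  have e1 : (I ^ (h * N)).map R.subtype = (Ideal.span {(⟨x ^ N, hxR⟩ : R)}).map R.subtype := by
    rw [Ideal.map_pow, aux_map_comap R P hP q hq, pow_mul, hx, Ideal.span_singleton_pow,
      Ideal.map_span]
    simp
  have cI : IsCoprime I (P.comap R.subtype) := by
    obtain ⟨a, ha, c, hc, hac⟩ := Ideal.isCoprime_iff_exists.mp hq
    have haR : a ∈ R := by
      have : a = 1 - c := by rw [← hac]; ring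
      rw [this]; exact R.sub_mem R.one_mem (hP c hc)
    exact Ideal.isCoprime_iff_exists.mpr ⟨⟨a, haR⟩, ha, ⟨c, hP c hc⟩, hc, Subtype.ext hac⟩
  have cx : IsCoprime (Ideal.span {(⟨x ^ N, hxR⟩ : R)}) (P.comap R.subtype) := by
    refine Ideal.isCoprime_iff_exists.mpr ⟨⟨x ^ N, hxR⟩, Ideal.mem_span_singleton_self _,
      -⟨x ^ N - 1, hP _ hxN⟩, ?_, Subtype.ext ?_⟩
    · exact neg_mem (show R.subtype _ ∈ P from hxN)
    · simp
  have e2 := congrArg (Ideal.comap R.subtype) e1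
  rw [aux_comap_map R P hP _ cI.pow_left, aux_comap_map R P hP _ cx] at e2
  have hne : h * N ≠ 0 := mul_ne_zero hh hN
  rw [← isUnit_pow_iff hne, ← FractionalIdeal.coeIdeal_pow, e2,
    FractionalIdeal.coeIdeal_span_singleton]
  have hz : (⟨x ^ N, hxR⟩ : R) ≠ 0 := fun h => pow_ne_zero N hx0 (congrArg Subtype.val h)
  have hz' : algebraMap R (FractionRing R) ⟨x ^ N, hxR⟩ ≠ 0 := by simpa using hz
  refine IsUnit.of_mul_eq_one (FractionalIdeal.spanSingleton _ (algebraMap R (FractionRing R) ⟨x ^ N, hxR⟩)⁻¹) ?_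
  rw [FractionalIdeal.spanSingleton_mul_spanSingleton, mul_inv_cancel₀ hz',
    FractionalIdeal.spanSingleton_one]

open nonZeroDivisors in
theorem aux_dav [Finite (ClassGroup O)] [P.IsMaximal] [Finite (O ⧸ P)] (hP : ∀ x ∈ P, x ∈ R)
    (D : ℕ) (hD : ∀ S : Multiset (ClassGroup R), Multiset.card S = D →
      ∃ T ≤ S, T ≠ 0 ∧ T.prod = 1) (S : Multiset (Ideal O)) (hS : ∀ q ∈ S, q ≠ ⊥ ∧ IsCoprime q P)
    (hc : Multiset.card S = D) :
    ∃ T ≤ S, T ≠ 0 ∧ ∃ g : R, T.prod = Ideal.span {(g : O)} := by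
  classical
  let φ : Ideal O → ClassGroup R := fun q =>
    if h : IsUnit ((q.comap R.subtype : Ideal R) : FractionalIdeal R⁰ (FractionRing R)) then
      ClassGroup.mk (FractionRing R) h.unit else 1
  obtain ⟨T, hT, hT0, hT1⟩ := hD (S.map φ) (by simpa using hc)
  have hm : T ∈ Multiset.powersetCard (Multiset.card T) (S.map φ) :=
    Multiset.mem_powersetCard.mpr ⟨hT, rfl⟩
  rw [Multiset.powersetCard_map, Multiset.mem_map] at hm
  obtain ⟨U, hU, hUT⟩ := hm
  have hUS := (Multiset.mem_powersetCard.mp hU).1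
  refine ⟨U, hUS, ?_, ?_⟩
  · rintro rfl
    exact hT0 (by simpa using hUT.symm)
  have key : ∀ V : Multiset (Ideal O), (∀ q ∈ V, q ≠ ⊥ ∧ IsCoprime q P) →
      ∃ (u : (FractionalIdeal R⁰ (FractionRing R))ˣ) (I : Ideal R),
        (u : FractionalIdeal R⁰ (FractionRing R)) = I ∧
        ClassGroup.mk (FractionRing R) u = (V.map φ).prod ∧ I.map R.subtype = V.prod := by
    intro V
    induction V using Multiset.induction with
    | empty =>
      intro _
      exact ⟨1, ⊤, by simp, by simp, by simp [Ideal.map_top]⟩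
    | cons q V ih =>
      intro hV
      obtain ⟨u, I, h1, h2, h3⟩ := ih fun r hr => hV r (Multiset.mem_cons_of_mem hr)
      obtain ⟨hq0, hq⟩ := hV q (Multiset.mem_cons_self _ _)
      have hu := aux_inv R P hP q hq0 hq
      refine ⟨hu.unit * u, q.comap R.subtype * I, ?_, ?_, ?_⟩
      · rw [FractionalIdeal.coeIdeal_mul, Units.val_mul, h1]; rfl
      · rw [map_mul, Multiset.map_cons, Multiset.prod_cons, h2]
        congr 1
        simp only [φ]
        rw [dif_pos hu]
      · rw [Ideal.map_mul, h3, aux_map_comap R P hP q hq, Multiset.prod_cons]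
  obtain ⟨u, I, h1, h2, h3⟩ := key U fun q hq => hS q (Multiset.mem_of_le hUS hq)
  rw [hUT, hT1, ClassGroup.mk_eq_one_of_coe_ideal h1] at h2
  obtain ⟨g, _, hg⟩ := h2
  refine ⟨g, ?_⟩
  rw [← h3, hg, Ideal.map_span]
  simp

end Aux

section Aux2
open UniqueFactorizationMonoid
variable {O : Type*} [CommRing O] [IsDedekindDomain O] (R : Subring O) (P : Ideal O)

/-- Multiset of prime ideal factors of the principal ideal generated by `x`. -/
noncomputable def auxFac (x : O) : Multiset (Ideal O) := normalizedFactors (Ideal.span {x})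

open Classical in
/-- Weight of a prime ideal: two if generated by an element of `R`, one otherwise. -/
noncomputable def auxW (q : Ideal O) : ℕ := if ∃ g : R, q = Ideal.span {(g : O)} then 2 else 1

theorem auxFac_mul {x y : O} (hx : x ≠ 0) (hy : y ≠ 0) :
    auxFac (x * y) = auxFac x + auxFac y := by
  unfold auxFac
  rw [← Ideal.span_singleton_mul_span_singleton, normalizedFactors_mul]
  · simpa using hx
  · simpa using hy

theorem auxFac_prod {x : O} (hx : x ≠ 0) : (auxFac x).prod = Ideal.span {x} :=
  Ideal.prod_normalizedFactors_eq_self (by simpa using hx)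

theorem auxFac_prime {x : O} {q : Ideal O} (hq : q ∈ auxFac x) : Prime q :=
  prime_of_normalized_factor _ hq

theorem auxFac_unit {x : O} (hx : x ≠ 0) : auxFac x = 0 ↔ IsUnit x := by
  constructor
  · intro h
    have := auxFac_prod hx
    rw [h, Multiset.prod_zero, Ideal.one_eq_top] at this
    exact Ideal.span_singleton_eq_top.mp this.symm
  · intro h
    unfold auxFac
    rw [Ideal.span_singleton_eq_top.mpr h, ← Ideal.one_eq_top, normalizedFactors_one]

theorem auxFac_sub {x g : O} (hx : x ≠ 0) (T : Multiset (Ideal O)) (hT : T ≤ auxFac x)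
    (hg : T.prod = Ideal.span {g}) : ∃ d, x = g * d ∧ auxFac g = T ∧ d ≠ 0 ∧ g ≠ 0 := by
  obtain ⟨T', hT'⟩ := Multiset.le_iff_exists_add.mp hT
  have h1 := auxFac_prod hx
  rw [hT', Multiset.prod_add, hg] at h1
  have : x ∈ Ideal.span {g} := by
    have : x ∈ Ideal.span {g} * T'.prod := by rw [h1]; exact Ideal.mem_span_singleton_self x
    exact (Ideal.mul_le_left (I := Ideal.span {g}) (J := T'.prod)) this
  obtain ⟨d, rfl⟩ := Ideal.mem_span_singleton.mp this
  refine ⟨d, rfl, ?_, right_ne_zero_of_mul hx, left_ne_zero_of_mul hx⟩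
  unfold auxFac
  rw [← hg]
  exact normalizedFactors_prod_of_prime fun q hq => auxFac_prime (Multiset.mem_of_le hT hq)

theorem auxW_two {q : Ideal O} (g : R) (h : q = Ideal.span {(g : O)}) : auxW R q = 2 := by
  unfold auxW; rw [if_pos ⟨g, h⟩]

theorem auxW_one {q : Ideal O} (h : ¬ ∃ g : R, q = Ideal.span {(g : O)}) : auxW R q = 1 := by
  unfold auxW; rw [if_neg h]

theorem auxW_pos (q : Ideal O) : 1 ≤ auxW R q := by
  unfold auxW; split_ifs <;> norm_num

theorem auxW_sum_card (S : Multiset (Ideal O))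
    (h : ∀ q ∈ S, ¬ ∃ g : R, q = Ideal.span {(g : O)}) :
    (S.map (auxW R)).sum = Multiset.card S := by
  rw [Multiset.map_congr rfl (fun q hq => auxW_one R (h q hq))]
  simp

theorem aux_lower [P.IsMaximal] [Finite (O ⧸ P)] (hP : ∀ x ∈ P, x ∈ R) (x : R) (hx0 : x ≠ 0)
    (hx : ¬ IsUnit x) : 2 ≤ ((auxFac (x : O)).map (auxW R)).sum := by
  have hx0' : (x : O) ≠ 0 := fun h => hx0 (Subtype.ext h)
  have hxu : ¬ IsUnit (x : O) := fun h => hx (aux_unit R P hP x h)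
  rw [← auxFac_unit hx0'] at hxu
  obtain ⟨q, hq⟩ := Multiset.exists_mem_of_ne_zero hxu
  obtain ⟨T, hT⟩ := Multiset.exists_cons_of_mem hq
  rw [hT, Multiset.map_cons, Multiset.sum_cons]
  have h1 := auxW_pos R q
  by_cases hT0 : T = 0
  · have := auxFac_prod hx0'
    rw [hT, hT0] at this
    rw [auxW_two R x (by simpa using this)]
    omega
  · obtain ⟨r, hr⟩ := Multiset.exists_mem_of_ne_zero hT0
    obtain ⟨U, rfl⟩ := Multiset.exists_cons_of_mem hr
    rw [Multiset.map_cons, Multiset.sum_cons]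
    have := auxW_pos R r
    omega

theorem aux_exists_le_card {α : Type*} (S : Multiset α) (D : ℕ) (h : D ≤ Multiset.card S) :
    ∃ T ≤ S, Multiset.card T = D := by
  have : Multiset.powersetCard D S ≠ 0 := by
    intro h0
    have := congrArg Multiset.card h0
    rw [Multiset.card_powersetCard, Multiset.card_zero] at this
    exact (Nat.choose_pos h).ne' this
  obtain ⟨T, hT⟩ := Multiset.exists_mem_of_ne_zero this
  exact ⟨T, Multiset.mem_powersetCard.mp hT⟩

theorem aux_upper [Finite (ClassGroup O)] [P.IsMaximal] [Finite (O ⧸ P)] (hP : ∀ x ∈ P, x ∈ R)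
    (hP0 : P ≠ ⊥) (π : R) (hπ : P = Ideal.span {(π : O)})
    (D : ℕ) (hD : ∀ S : Multiset (ClassGroup R), Multiset.card S = D →
      ∃ T ≤ S, T ≠ 0 ∧ T.prod = 1) (x : R) (hx : Irreducible x) :
    ((auxFac (x : O)).map (auxW R)).sum ≤ D + 1 := by
  have hx0' : (x : O) ≠ 0 := fun h => hx.ne_zero (Subtype.ext h)
  have hPt : P ≠ ⊤ := Ideal.IsMaximal.ne_top ‹_›
  have hPp : Prime P := Ideal.prime_of_isPrime hP0 inferInstance
  have hD1 : 1 ≤ D := by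
    by_contra h
    obtain ⟨T, hT, hT0, _⟩ := hD 0 (by simp; omega)
    exact hT0 (by simpa using hT)
  have hcop : ∀ q : Ideal O, Prime q → q ≠ P → IsCoprime q P := by
    intro q hq hqP
    have hm : q.IsMaximal := (Ideal.isPrime_of_prime hq).isMaximal hq.ne_zero
    rw [Ideal.isCoprime_iff_sup_eq]
    exact hm.coprime_of_ne ‹_› hqP
  have huni : ∀ {g : R}, IsUnit g → IsUnit (g : O) := fun h => h.map R.subtype
  have hπ0 : (π : O) ≠ 0 := by
    intro h
    rw [h] at hπ
    exact hP0 (by simpa using hπ)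
  have hπu : ¬ IsUnit (π : O) := fun h => hPt (by rw [hπ]; exact Ideal.span_singleton_eq_top.mpr h)
  by_cases hxP : (x : O) ∈ P
  · rw [hπ] at hxP
    obtain ⟨b, hb⟩ := Ideal.mem_span_singleton.mp hxP
    have hb0 : b ≠ 0 := by rintro rfl; exact hx0' (by simpa using hb)
    -- no nonempty sub-multiset of the factors of b is generated by an element of R
    have hno : ∀ T ≤ auxFac b, T ≠ 0 → ¬ ∃ g : R, T.prod = Ideal.span {(g : O)} := by
      rintro T hT hT0 ⟨g, hg⟩
      obtain ⟨d, hd, hgT, hd0, hg0⟩ := auxFac_sub hb0 T hT hg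
      have hgu : ¬ IsUnit (g : O) := by rw [← auxFac_unit hg0, hgT]; exact hT0
      have hdP : (π : O) * d ∈ P := by rw [hπ]; exact Ideal.mul_mem_right _ _ (Ideal.mem_span_singleton_self _)
      have : x = g * ⟨π * d, hP _ hdP⟩ := by
        apply Subtype.ext
        change (x : O) = g * (π * d)
        rw [hb, hd]; ring
      rcases hx.isUnit_or_isUnit this with h | h
      · exact hgu (huni h)
      · exact hπu (isUnit_of_mul_isUnit_left (huni h))
    have hno1 : ∀ q ∈ auxFac b, ¬ ∃ g : R, q = Ideal.span {(g : O)} := by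
      intro q hq h
      exact hno {q} (by simpa using hq) (by simp) (by simpa using h)
    have hprm : auxFac (π : O) = {P} := by
      unfold auxFac
      rw [← hπ]
      have := normalizedFactors_prod_of_prime (m := ({P} : Multiset (Ideal O)))
        (by simpa using hPp)
      simpa using this
    rw [hb, auxFac_mul hπ0 hb0, hprm, Multiset.map_add, Multiset.sum_add,
      auxW_sum_card R _ hno1, Multiset.map_singleton, Multiset.sum_singleton, auxW_two R π hπ]
    by_contra hlt
    obtain ⟨S, hS, hSD⟩ := aux_exists_le_card (auxFac b) D (by omega)
    obtain ⟨T, hT, hT0, hg⟩ := aux_dav R P hP D hD S (fun q hq => by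
      have hq := Multiset.mem_of_le hS hq
      refine ⟨(auxFac_prime hq).ne_zero, hcop q (auxFac_prime hq) ?_⟩
      rintro rfl
      exact hno1 _ hq ⟨π, hπ⟩) hSD
    exact hno T (hT.trans hS) hT0 hg
  · -- a nonempty sub-multiset generated by an element of R is everything
    have hall : ∀ T ≤ auxFac (x : O), T ≠ 0 → (∃ g : R, T.prod = Ideal.span {(g : O)}) →
        auxFac (x : O) = T := by
      rintro T hT hT0 ⟨g, hg⟩
      obtain ⟨d, hd, hgT, hd0, hg0⟩ := auxFac_sub hx0' T hT hg
      have hgu : ¬ IsUnit (g : O) := by rw [← auxFac_unit hg0, hgT]; exact hT0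
      have hgP : (g : O) ∉ P := fun h => hxP (by rw [hd]; exact P.mul_mem_right _ h)
      have hdR : d ∈ R := aux_div R P hP g d g.2 hgP (by rw [← hd]; exact x.2)
      have : x = g * ⟨d, hdR⟩ := Subtype.ext hd
      rcases hx.isUnit_or_isUnit this with h | h
      · exact absurd (huni h) hgu
      · have hdu : IsUnit d := huni h
        rw [hd, auxFac_mul hg0 hd0, (auxFac_unit hd0).mpr hdu, hgT, add_zero]
    by_cases hgood : ∃ q ∈ auxFac (x : O), ∃ g : R, q = Ideal.span {(g : O)}
    · obtain ⟨q, hq, g, hg⟩ := hgood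
      rw [hall {q} (by simpa using hq) (by simp) ⟨g, by simpa using hg⟩]
      rw [Multiset.map_singleton, Multiset.sum_singleton, auxW_two R g hg]
      omega
    · rw [auxW_sum_card R _ (fun q hq h => hgood ⟨q, hq, h⟩)]
      by_contra hlt
      obtain ⟨S, hS, hSD⟩ := aux_exists_le_card (auxFac (x : O)) D (by omega)
      obtain ⟨T, hT, hT0, hg⟩ := aux_dav R P hP D hD S (fun q hq => by
        have hq := Multiset.mem_of_le hS hq
        refine ⟨(auxFac_prime hq).ne_zero, hcop q (auxFac_prime hq) ?_⟩
        rintro rfl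
        exact hgood ⟨_, hq, ⟨π, hπ⟩⟩) hSD
      have h1 := hall T (hT.trans hS) hT0 hg
      have h2 := Multiset.card_le_card hT
      rw [← h1] at h2
      omega

theorem aux_sum {ι : Type*} (s : Finset ι) (f : ι → R) (hf : ∀ i ∈ s, f i ≠ 0) :
    ((auxFac ((∏ i ∈ s, f i : R) : O)).map (auxW R)).sum =
      ∑ i ∈ s, ((auxFac (f i : O)).map (auxW R)).sum := by
  classical
  induction s using Finset.induction with
  | empty =>
    rw [Finset.prod_empty, Finset.sum_empty]
    have : auxFac ((1 : R) : O) = 0 := (auxFac_unit (by simp)).mpr (by simp)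
    rw [this]; simp
  | insert i s hi ih =>
    have h1 : ((f i : R) : O) ≠ 0 := fun h => hf i (Finset.mem_insert_self _ _) (Subtype.ext h)
    have h2 : ((∏ i ∈ s, f i : R) : O) ≠ 0 := fun h =>
      Finset.prod_ne_zero_iff.mpr (fun j hj => hf j (Finset.mem_insert_of_mem hj)) (Subtype.ext h)
    rw [Finset.prod_insert hi, Finset.sum_insert hi, ← ih fun j hj => hf j (Finset.mem_insert_of_mem hj)]
    rw [Subring.coe_mul, auxFac_mul h1 h2, Multiset.map_add, Multiset.sum_add]

end Aux2

/-- If the conductor of the order `R` is a principal prime ideal `π𝓞_K` with `π ∈ R`,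
and every multiset of `D` elements of `Cl(R)` has a nonempty zero-sum (product-one)
submultiset, then for any two irreducible factorizations `α = π_1⋯π_m = τ_1⋯τ_n` of a
nonzero nonunit `α ∈ R` with `m ≤ n`, one has `2n ≤ (D+1)·m`
(the elasticity of `R` is at most `(D+1)/2`). -/
theorem stmt_11 {K : Type*} [Field K] [NumberField K] (R : Subring (𝓞 K))
    (hR : Finite ((𝓞 K) ⧸ R.toAddSubgroup))
    (π : R)
    (hPprime : (conductorIdeal R).IsPrime)
    (hPeq : conductorIdeal R = Ideal.span {(π : 𝓞 K)})
    (D : ℕ)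
    (hD : ∀ S : Multiset (ClassGroup R), Multiset.card S = D →
      ∃ T ≤ S, T ≠ 0 ∧ T.prod = 1)
    (α : R) (hα0 : α ≠ 0) (hαu : ¬IsUnit α)
    (m n : ℕ) (p : Fin m → R) (t : Fin n → R)
    (hp : ∀ i, Irreducible (p i)) (ht : ∀ j, Irreducible (t j))
    (hpeq : α = ∏ i, p i) (hteq : α = ∏ j, t j) (hmn : m ≤ n) :
    2 * n ≤ (D + 1) * m := by
  have hP : ∀ x ∈ conductorIdeal R, x ∈ R := fun x hx => by
    have := hx 1
    rwa [mul_one] at this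
  have hP0 : conductorIdeal R ≠ ⊥ := by
    intro h
    have hk : ((Nat.card ((𝓞 K) ⧸ R.toAddSubgroup) : ℕ) : 𝓞 K) ∈ conductorIdeal R := by
      intro y
      have h1 : Nat.card ((𝓞 K) ⧸ R.toAddSubgroup) • (QuotientAddGroup.mk y :
        (𝓞 K) ⧸ R.toAddSubgroup) = 0 := card_nsmul_eq_zero'
      rw [← QuotientAddGroup.mk_nsmul, QuotientAddGroup.eq_zero_iff] at h1
      rw [← nsmul_eq_mul]
      exact h1
    rw [h, Ideal.mem_bot] at hk
    exact Nat.card_pos.ne' (Nat.cast_eq_zero.mp hk)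
  have hmax : (conductorIdeal R).IsMaximal := hPprime.isMaximal hP0
  have hfin : Finite (𝓞 K ⧸ conductorIdeal R) := Ideal.finiteQuotientOfFreeOfNeBot _ hP0
  have e1 := aux_sum R Finset.univ p fun i _ => (hp i).ne_zero
  have e2 := aux_sum R Finset.univ t fun i _ => (ht i).ne_zero
  rw [← hpeq] at e1
  rw [← hteq] at e2
  have up : ∑ i, ((auxFac (p i : 𝓞 K)).map (auxW R)).sum ≤ ∑ _i : Fin m, (D + 1) :=
    Finset.sum_le_sum fun i _ =>
      aux_upper R (conductorIdeal R) hP hP0 π hPeq D hD (p i) (hp i)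
  have lo : ∑ _j : Fin n, 2 ≤ ∑ j, ((auxFac (t j : 𝓞 K)).map (auxW R)).sum :=
    Finset.sum_le_sum fun j _ =>
      aux_lower R (conductorIdeal R) hP (t j) (ht j).ne_zero (ht j).not_isUnit
  rw [← e1] at up
  rw [← e2] at lo
  have := lo.trans up
  simp only [Finset.sum_const, Finset.card_univ, Fintype.card_fin, smul_eq_mul] at this
  linarith
end
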